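/- Let p > 3 be prime and let E : y² = x³ + ax + b be an elliptic curve over F_p with a ≠ 0, b ≠ 0 and 4a³ + 27b² ≠ 0 (equivalently, E is nonsingular with j(E) ≠ 0, 1728). Then, as an identity in ℚ_p, a_p(E) = φ(b) · p · ₂G₂[1/4, 3/4; 1/3, 2/3 | −27b²/(4a³)]_p, i.e. a_p(E) = φ(b) · p · (−1/(p−1)) · Σ_{j=0}^{p−2} ω̄^j(−27b²/(4a³)) · [Γ_p(⟨1/4 − j/(p−1)⟩)Γ_p(⟨3/4 − j/(p−1)⟩)/(Γ_p(1/4)Γ_p(3/4))] · [Γ_p(⟨−1/3 + j/(p−1)⟩)Γ_p(⟨−2/3 + j/(p−1)⟩)/(Γ_p(2/3)Γ_p(1/3))] · (−p)^{−⌊1/4 − j/(p−1)⌋ − ⌊3/4 − j/(p−1)⌋ − ⌊2/3 + j/(p−1)⌋ − ⌊1/3 + j/(p−1)⌋}. -/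

import Mathlib

/-- The rational `q`, regarded as a `p`-adic integer (when `q ∈ ℚ ∩ ℤ_p`). -/
noncomputable def toZp (p : ℕ) [Fact p.Prime] (q : ℚ) : ℤ_[p] :=
  if h : ‖(q : ℚ_[p])‖ ≤ 1 then ⟨(q : ℚ_[p]), h⟩ else 0

/-- McCarthy's function `ₙGₙ[a₁,…,aₙ; b₁,…,bₙ | t]_p`, defined in terms of the
`p`-adic gamma function `Γ` and the Teichmüller character `ω` (given as parameters). -/
noncomputable def padicG (p : ℕ) [Fact p.Prime] (Γ : ℤ_[p] → ℤ_[p])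
    (ω : ZMod p → ℤ_[p]) (n : ℕ) (A B : Fin n → ℚ) (t : ZMod p) : ℚ_[p] :=
  -1 / ((p : ℚ_[p]) - 1) * ∑ j ∈ Finset.range (p - 1),
    (-1 : ℚ_[p]) ^ (j * n) * ((((ω t : ℚ_[p]))⁻¹) ^ j) *
    ∏ i : Fin n,
      ((Γ (toZp p (Int.fract (A i - (j : ℚ) / ((p : ℚ) - 1)))) : ℚ_[p]) /
          (Γ (toZp p (Int.fract (A i))) : ℚ_[p]) *
        ((Γ (toZp p (Int.fract (-(B i) + (j : ℚ) / ((p : ℚ) - 1)))) : ℚ_[p]) /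
          (Γ (toZp p (Int.fract (-(B i)))) : ℚ_[p])) *
        (-(p : ℚ_[p])) ^
          (-Int.floor (Int.fract (A i) - (j : ℚ) / ((p : ℚ) - 1)) -
            Int.floor (Int.fract (-(B i)) + (j : ℚ) / ((p : ℚ) - 1))))

namespace PowerSeries

variable {F : Type*} [Field F] [CharZero F]

/-- The formal exponential `exp (f)` of a power series without constant term. -/
noncomputable def expSubst (f : F⟦X⟧) : F⟦X⟧ := (exp F).subst f

theorem constantCoeff_expSubst {f : F⟦X⟧} (hf : constantCoeff f = 0) :
    constantCoeff (expSubst f) = 1 := by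
  have := constantCoeff_subst_eq_zero (R := F) hf (exp F - 1) (by simp)
  rw [← coe_substAlgHom (HasSubst.of_constantCoeff_zero' hf), map_sub, map_one] at this
  rw [expSubst, ← coe_substAlgHom (HasSubst.of_constantCoeff_zero' hf)]
  rw [map_sub, sub_eq_zero] at this
  exact this.trans (map_one _)

theorem derivative_expSubst {f : F⟦X⟧} (hf : constantCoeff f = 0) :
    derivative F (expSubst f) = expSubst f * derivative F f := by
  rw [expSubst, derivative_subst (HasSubst.of_constantCoeff_zero' hf), derivative_exp]

theorem eq_of_derivative_eq_mul {f g d : F⟦X⟧} (h0 : constantCoeff f = constantCoeff g)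
    (hf : derivative F f = f * d) (hg : derivative F g = g * d) : f = g := by
  ext n
  induction n using Nat.strong_induction_on with
  | _ n ih =>
    cases n with
    | zero => simpa using h0
    | succ n =>
      have h1 := congrArg (coeff n) hf
      have h2 := congrArg (coeff n) hg
      rw [coeff_derivative, coeff_mul] at h1 h2
      have h3 : (∑ x ∈ Finset.HasAntidiagonal.antidiagonal n, coeff x.1 f * coeff x.2 d) =
          ∑ x ∈ Finset.HasAntidiagonal.antidiagonal n, coeff x.1 g * coeff x.2 d := by
        refine Finset.sum_congr rfl fun x hx => ?_
        rw [ih x.1 (by have := Finset.HasAntidiagonal.mem_antidiagonal.1 hx; omega)]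
      rw [← h3, ← h1] at h2
      exact (mul_right_cancel₀ (by exact_mod_cast Nat.succ_ne_zero n) h2).symm

theorem expSubst_add {f g : F⟦X⟧} (hf : constantCoeff f = 0) (hg : constantCoeff g = 0) :
    expSubst (f + g) = expSubst f * expSubst g := by
  have hfg : constantCoeff (f + g) = 0 := by simp [hf, hg]
  refine eq_of_derivative_eq_mul (d := derivative F (f + g)) ?_ (derivative_expSubst hfg) ?_
  · rw [map_mul, constantCoeff_expSubst hfg, constantCoeff_expSubst hf, constantCoeff_expSubst hg,
      mul_one]
  · rw [Derivation.leibniz, derivative_expSubst hf, derivative_expSubst hg, map_add]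
    simp only [smul_eq_mul]
    ring

theorem expSubst_zero : expSubst (0 : F⟦X⟧) = 1 :=
  eq_of_derivative_eq_mul (d := 0) (by rw [constantCoeff_expSubst (by simp)]; simp)
    (by rw [derivative_expSubst (by simp)]; simp) (by simp)

theorem expSubst_nsmul {f : F⟦X⟧} (hf : constantCoeff f = 0) (n : ℕ) :
    expSubst (n • f) = expSubst f ^ n := by
  induction n with
  | zero => simp [expSubst_zero]
  | succ n ih =>
    rw [succ_nsmul, expSubst_add (by simp [hf]) hf, ih, pow_succ]

theorem expand_expSubst {f : F⟦X⟧} (hf : constantCoeff f = 0) (n : ℕ) (hn : n ≠ 0) :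
    expand n hn (expSubst f) = expSubst (expand n hn f) := by
  have hX : HasSubst (X ^ n : F⟦X⟧) := HasSubst.X_pow hn
  rw [expSubst, expSubst, expand_apply, expand_apply,
    subst_comp_subst_apply (HasSubst.of_constantCoeff_zero' hf) hX]

theorem coeff_expSubst_C_mul_X (c : F) (n : ℕ) :
    coeff n (expSubst (C c * X)) = c ^ n / n.factorial := by
  have : expSubst (C c * X) = rescale c (exp F) := by
    refine eq_of_derivative_eq_mul (d := C c) ?_ ?_ ?_
    · rw [constantCoeff_expSubst (by simp)]; simp [← coeff_zero_eq_constantCoeff, coeff_exp]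
    · rw [derivative_expSubst (by simp)]; simp
    · ext n
      rw [coeff_derivative, coeff_mul_C]
      simp only [coeff_rescale, coeff_exp, Nat.factorial_succ]
      have := Nat.cast_add_one_ne_zero (R := F) n
      have := Nat.factorial_ne_zero n
      simp
      field_simp
      ring
  rw [this]
  simp [coeff_rescale, coeff_exp, div_eq_mul_inv]

end PowerSeries

section Dwork

open PowerSeries

variable (p : ℕ) [hp : Fact p.Prime]

theorem Padic.norm_factorial (n : ℕ) :
    ‖(n.factorial : ℚ_[p])‖ = ((p : ℝ)⁻¹) ^ padicValNat p n.factorial := by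
  have h0 : (n.factorial : ℚ_[p]) ≠ 0 := by exact_mod_cast n.factorial_ne_zero
  rw [Padic.norm_eq_zpow_neg_valuation h0, Padic.valuation_natCast, zpow_neg, zpow_natCast, inv_pow]

theorem Padic.norm_pow_div_factorial_le {n : ℕ} (hn : n ≠ 0) :
    ‖(p : ℚ_[p]) ^ n / n.factorial‖ ≤ (p : ℝ)⁻¹ := by
  have hp0 : (0 : ℝ) < (p : ℝ)⁻¹ := by have := hp.out.pos; positivity
  have hp1 : (p : ℝ)⁻¹ ≤ 1 := inv_le_one_of_one_le₀ (by exact_mod_cast hp.out.one_le)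
  rw [norm_div, norm_pow, Padic.norm_p, Padic.norm_factorial, div_le_iff₀ (by positivity),
    ← pow_succ']
  exact pow_le_pow_of_le_one hp0.le hp1 (padicValNat_factorial_lt_of_ne_zero p hn)

theorem PowerSeries.expand_eq_pow_zmod (f : (ZMod p)⟦X⟧) :
    expand p hp.out.ne_zero f = f ^ p := by
  have h := MvPowerSeries.map_frobenius_expand p hp.out.ne_zero (f := f)
  rw [ZMod.frobenius_zmod p] at h
  rw [← h, MvPowerSeries.map_id]
  rfl

theorem PowerSeries.norm_coeff_expand_sub_pow_le (g : ℤ_[p]⟦X⟧) (n : ℕ) :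
    ‖coeff n (expand p hp.out.ne_zero g - g ^ p)‖ ≤ (p : ℝ)⁻¹ := by
  have h : PadicInt.toZMod (coeff n (expand p hp.out.ne_zero g - g ^ p)) = 0 := by
    rw [← coeff_map, map_sub, map_pow, map_expand, expand_eq_pow_zmod, sub_self, map_zero]
  rw [← RingHom.mem_ker, PadicInt.ker_toZMod, PadicInt.maximalIdeal_eq_span_p] at h
  have := (PadicInt.norm_le_pow_iff_mem_span_pow _ 1).2 (by simpa using h)
  simpa using this

open Classical in
/-- The series `∑ X ^ (p ^ i) / p ^ i`. -/
noncomputable def artinHasseLog : ℚ_[p]⟦X⟧ :=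
  mk fun n => if ∃ i, n = p ^ i then (n : ℚ_[p])⁻¹ else 0

theorem constantCoeff_artinHasseLog : constantCoeff (artinHasseLog p) = 0 := by
  rw [← coeff_zero_eq_constantCoeff_apply, artinHasseLog, coeff_mk]
  simp

theorem artinHasseLog_eq : artinHasseLog p =
    X + C (p : ℚ_[p])⁻¹ * expand p hp.out.ne_zero (artinHasseLog p) := by
  ext n
  rw [map_add, coeff_C_mul, coeff_expand, coeff_X]
  simp only [artinHasseLog, coeff_mk]
  by_cases hpn : p ∣ n
  · obtain ⟨m, rfl⟩ := hpn
    have h1 : p * m ≠ 1 := fun h => hp.out.one_lt.ne' (Nat.eq_one_of_mul_eq_one_right h)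
    have h2 : (∃ i, p * m = p ^ i) ↔ ∃ i, m = p ^ i := by
      constructor
      · rintro ⟨_ | i, hi⟩
        · exact absurd hi h1
        · exact ⟨i, Nat.eq_of_mul_eq_mul_left hp.out.pos (by rw [hi, pow_succ'])⟩
      · rintro ⟨i, rfl⟩
        exact ⟨i + 1, by rw [pow_succ']⟩
    rw [if_neg h1, if_pos (dvd_mul_right p m), Nat.mul_div_cancel_left _ hp.out.pos]
    by_cases hm : ∃ i, m = p ^ i
    · rw [if_pos (h2.2 hm), if_pos hm]
      simp [mul_comm]
    · rw [if_neg (mt h2.1 hm), if_neg hm]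
      simp
  · rw [if_neg hpn]
    by_cases h1 : n = 1
    · rw [if_pos ⟨0, by simpa using h1⟩]
      simp [h1]
    · rw [if_neg, if_neg h1]
      · simp
      · rintro ⟨_ | i, hi⟩
        · exact h1 hi
        · exact hpn ⟨p ^ i, by rw [hi, pow_succ']⟩

theorem expSubst_artinHasseLog_pow : expSubst (artinHasseLog p) ^ p =
    expSubst (C (p : ℚ_[p]) * X) * expand p hp.out.ne_zero (expSubst (artinHasseLog p)) := by
  have h0 := constantCoeff_artinHasseLog p
  have hp0 : (p : ℚ_[p]) ≠ 0 := by exact_mod_cast hp.out.ne_zero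
  rw [expand_expSubst h0, ← expSubst_nsmul h0, ← expSubst_add (by simp) (by simp [h0])]
  congr 1
  conv_lhs => rw [artinHasseLog_eq]
  rw [nsmul_eq_mul, mul_add, ← mul_assoc]
  have : (p : ℚ_[p]⟦X⟧) = C (p : ℚ_[p]) := by simp
  rw [this, ← map_mul, mul_inv_cancel₀ hp0, map_one, one_mul]

theorem norm_coeff_expSubst_artinHasseLog_le (n : ℕ) :
    ‖coeff n (expSubst (artinHasseLog p))‖ ≤ 1 := by
  have h0 := constantCoeff_artinHasseLog p
  induction n using Nat.strong_induction_on with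
  | _ n ih =>
  rcases Nat.eq_zero_or_pos n with rfl | hn
  · rw [coeff_zero_eq_constantCoeff_apply, constantCoeff_expSubst h0, norm_one]
  set f := expSubst (artinHasseLog p) with hf
  have hfc : constantCoeff f = 1 := constantCoeff_expSubst h0
  have hc : ∀ m, ∃ z : ℤ_[p], (z : ℚ_[p]) = if m < n then coeff m f else 0 := by
    intro m
    split_ifs with h
    · exact ⟨⟨coeff m f, ih m h⟩, rfl⟩
    · exact ⟨0, rfl⟩
  choose c hc using hc
  let g : ℤ_[p]⟦X⟧ := mk c
  let G : ℚ_[p]⟦X⟧ := PowerSeries.map PadicInt.Coe.ringHom g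
  have hG : ∀ m, coeff m G = if m < n then coeff m f else 0 := by
    intro m
    simp only [G, g, coeff_map, coeff_mk, ← hc]
    rfl
  have hGc : constantCoeff G = 1 := by
    rw [← coeff_zero_eq_constantCoeff_apply, hG, if_pos hn, coeff_zero_eq_constantCoeff_apply, hfc]
  obtain ⟨h, hh⟩ : X ^ n ∣ f - G := by
    rw [X_pow_dvd_iff]
    intro m hm
    rw [map_sub, hG, if_pos hm, sub_self]
  have hhc : constantCoeff h = coeff n f := by
    have := congrArg (coeff n) hh
    rw [map_sub, hG, if_neg (lt_irrefl n), sub_zero, coeff_X_pow_mul'] at this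
    simpa using this.symm
  have hpow : coeff n (f ^ p) = coeff n (G ^ p) + p * coeff n f := by
    have h1 : f ^ p - G ^ p = (∑ i ∈ Finset.range p, f ^ i * G ^ (p - 1 - i)) * (f - G) :=
      ((Commute.all f G).geom_sum₂_mul p).symm
    rw [hh, mul_left_comm] at h1
    have h2 := congrArg (coeff n) h1
    rw [map_sub, coeff_X_pow_mul'] at h2
    simp [hhc, hfc, hGc] at h2
    rw [← h2]; ring
  have hexp : coeff n (f ^ p) = coeff n (expand p hp.out.ne_zero f) +
      ∑ i ∈ Finset.range n, (p : ℚ_[p]) ^ (i + 1) / (i + 1).factorial *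
        coeff (n - (i + 1)) (expand p hp.out.ne_zero f) := by
    rw [hf, expSubst_artinHasseLog_pow, coeff_mul, Finset.Nat.sum_antidiagonal_eq_sum_range_succ_mk,
      Finset.sum_range_succ', add_comm]
    simp only [coeff_expSubst_C_mul_X]
    simp
  have hexpG : coeff n (expand p hp.out.ne_zero f) = coeff n (expand p hp.out.ne_zero G) := by
    rw [coeff_expand, coeff_expand, hG, if_pos (Nat.div_lt_self hn hp.out.one_lt)]
  have hp0 : (0 : ℝ) < (p : ℝ)⁻¹ := by have := hp.out.pos; positivity
  have key : (p : ℚ_[p]) * coeff n f = coeff n (expand p hp.out.ne_zero G - G ^ p) +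
      ∑ i ∈ Finset.range n, (p : ℚ_[p]) ^ (i + 1) / (i + 1).factorial *
        coeff (n - (i + 1)) (expand p hp.out.ne_zero f) := by
    rw [map_sub, ← hexpG, sub_add_eq_add_sub, ← hexp, hpow]; ring
  have hle : ‖(p : ℚ_[p]) * coeff n f‖ ≤ (p : ℝ)⁻¹ := by
    rw [key]
    refine (IsUltrametricDist.norm_add_le_max _ _).trans (max_le ?_ ?_)
    · have := norm_coeff_expand_sub_pow_le p g n
      simp only [G, ← map_expand, ← map_pow, ← map_sub, coeff_map]
      exact this
    · refine IsUltrametricDist.norm_sum_le_of_forall_le_of_nonneg hp0.le fun i _ => ?_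
      rw [norm_mul]
      refine (mul_le_mul (Padic.norm_pow_div_factorial_le p i.succ_ne_zero) ?_ (norm_nonneg _)
        hp0.le).trans_eq (mul_one _)
      rw [coeff_expand]
      split_ifs
      · exact ih _ ((Nat.div_le_self _ _).trans_lt (by omega))
      · simp
  rw [norm_mul, Padic.norm_p] at hle
  exact le_of_mul_le_mul_left (by simpa using hle) hp0

end Dwork

section Dwork

open PowerSeries

variable (p : ℕ) [hp : Fact p.Prime]

/-- Dwork's series `exp (X + X ^ p / p)`. -/
noncomputable def dworkExp : ℚ_[p]⟦X⟧ := expSubst (X + C (p : ℚ_[p])⁻¹ * X ^ p)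

theorem constantCoeff_C_mul_X_pow_prime {c : ℚ_[p]} :
    constantCoeff (C c * X ^ p : ℚ_[p]⟦X⟧) = 0 := by
  simp [hp.out.ne_zero]

theorem dworkExp_eq_mul :
    dworkExp p = expSubst X * expand p hp.out.ne_zero (expSubst (C (p : ℚ_[p])⁻¹ * X)) := by
  rw [expand_expSubst (by simp), dworkExp, expSubst_add (by simp)
    (constantCoeff_C_mul_X_pow_prime p), map_mul, expand_C, expand_X]

theorem dworkExp_pow_prime : dworkExp p ^ p =
    expSubst (C (p : ℚ_[p]) * X) * expand p hp.out.ne_zero (expSubst X) := by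
  have hp0 : (p : ℚ_[p]) ≠ 0 := by exact_mod_cast hp.out.ne_zero
  have hpC : (p : ℚ_[p]⟦X⟧) = C (p : ℚ_[p]) := by simp
  rw [dworkExp_eq_mul, mul_pow, ← map_pow, ← expSubst_nsmul (by simp), ← expSubst_nsmul (by simp),
    nsmul_eq_mul, nsmul_eq_mul, hpC, ← mul_assoc, ← map_mul, mul_inv_cancel₀ hp0, map_one, one_mul]

theorem coeff_dworkExp_zero : coeff 0 (dworkExp p) = 1 := by
  rw [coeff_zero_eq_constantCoeff_apply, dworkExp, constantCoeff_expSubst]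
  rw [map_add, constantCoeff_C_mul_X_pow_prime]
  simp

theorem succ_mul_coeff_dworkExp_succ (n : ℕ) :
    (n + 1 : ℚ_[p]) * coeff (n + 1) (dworkExp p) =
      coeff n (dworkExp p) + if p ≤ n + 1 then coeff (n + 1 - p) (dworkExp p) else 0 := by
  have hp0 : (p : ℚ_[p]) ≠ 0 := by exact_mod_cast hp.out.ne_zero
  have h := congrArg (coeff n) (derivative_expSubst (F := ℚ_[p]) (f := X + C (p : ℚ_[p])⁻¹ * X ^ p)
    (by rw [map_add, constantCoeff_C_mul_X_pow_prime]; simp))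
  rw [← dworkExp, coeff_derivative] at h
  have hd : derivative ℚ_[p] (X + C (p : ℚ_[p])⁻¹ * X ^ p) = 1 + X ^ (p - 1) := by
    rw [map_add, derivative_X, Derivation.leibniz, derivative_pow, derivative_X, derivative_C]
    have hpC : (p : ℚ_[p]⟦X⟧) = C (p : ℚ_[p]) := by simp
    rw [hpC, smul_eq_mul, smul_zero, add_zero, mul_one, ← mul_assoc, ← map_mul,
      inv_mul_cancel₀ hp0, map_one, one_mul]
  rw [hd, mul_add (dworkExp p), mul_one, map_add, coeff_mul_X_pow'] at h
  rw [mul_comm, h]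
  have := hp.out.pos
  congr 1
  by_cases hpn : p ≤ n + 1
  · rw [if_pos (by omega), if_pos hpn]
    congr 2
    omega
  · rw [if_neg (by omega), if_neg hpn]

theorem sum_coeff_dworkExp_mul (a N : ℕ) (ha : a < p) :
    ∑ m ∈ Finset.range (N + 1), coeff (a + p * (N - m)) (dworkExp p) *
      ((-(p : ℚ_[p])⁻¹) ^ m / m.factorial) = 1 / (a + p * N).factorial := by
  have hp0 := hp.out.pos
  have h : expSubst (X : ℚ_[p]⟦X⟧) = dworkExp p *
      expand p hp.out.ne_zero (expSubst (C (-(p : ℚ_[p])⁻¹) * X)) := by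
    rw [dworkExp_eq_mul, mul_assoc, ← map_mul, ← expSubst_add (by simp) (by simp), ← add_mul,
      ← map_add, add_neg_cancel, map_zero, zero_mul, expSubst_zero, map_one, mul_one]
  have h1 := congrArg (coeff (a + p * N)) h
  have h2 := coeff_expSubst_C_mul_X (1 : ℚ_[p]) (a + p * N)
  rw [map_one, one_mul] at h2
  rw [h2, one_pow, mul_comm (dworkExp p), coeff_mul,
    Finset.Nat.sum_antidiagonal_eq_sum_range_succ_mk] at h1
  rw [h1]
  refine Finset.sum_of_injOn (fun m => p * m) ?_ ?_ ?_ ?_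
  · exact fun x _ y _ hxy => Nat.eq_of_mul_eq_mul_left hp0 hxy
  · intro m hm
    have hm' : m ≤ N := Nat.lt_succ_iff.1 (Finset.mem_range.1 hm)
    have := Nat.mul_le_mul_left p hm'
    simp only [Finset.coe_range, Set.mem_Iio]
    omega
  · intro l hl hl'
    rw [coeff_expand, if_neg, zero_mul]
    rintro ⟨m, rfl⟩
    refine hl' ⟨m, ?_, rfl⟩
    have h3 : p * m < p * (N + 1) := by
      have := Finset.mem_range.1 hl
      rw [mul_add]
      omega
    simpa using Nat.lt_of_mul_lt_mul_left h3
  · intro m hm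
    have hm' : m ≤ N := Nat.lt_succ_iff.1 (Finset.mem_range.1 hm)
    rw [coeff_expand, if_pos (dvd_mul_right p m), Nat.mul_div_cancel_left m hp0,
      coeff_expSubst_C_mul_X, mul_comm, Nat.mul_sub, ← Nat.add_sub_assoc (Nat.mul_le_mul_left p hm')]

theorem coeff_dworkExp_of_lt {n : ℕ} (hn : n < p) :
    coeff n (dworkExp p) = 1 / n.factorial := by
  simpa using sum_coeff_dworkExp_mul p n 0 hn

theorem norm_coeff_derivative_artinHasseLog_le (n : ℕ) :
    ‖coeff n (derivative ℚ_[p] (artinHasseLog p))‖ ≤ 1 := by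
  rw [coeff_derivative, artinHasseLog, coeff_mk]
  split_ifs
  · rw [Nat.cast_succ, inv_mul_cancel₀ (Nat.cast_add_one_ne_zero n), norm_one]
  · simp

theorem norm_coeff_expSubst_neg_artinHasseLog_le (n : ℕ) :
    ‖(n.factorial : ℚ_[p]) * coeff n (expSubst (C (-((p : ℚ_[p])⁻¹ * (p : ℚ_[p])⁻¹)) *
      artinHasseLog p))‖ ≤ (p : ℝ) ^ (2 * n) := by
  have h0 := constantCoeff_artinHasseLog p
  have h0' : constantCoeff (C (-((p : ℚ_[p])⁻¹ * (p : ℚ_[p])⁻¹)) * artinHasseLog p) = 0 := by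
    simp [h0]
  have hp1 : (1 : ℝ) ≤ p := by exact_mod_cast hp.out.one_le
  induction n using Nat.strong_induction_on with
  | _ n ih =>
  rcases n with _ | n
  · rw [coeff_zero_eq_constantCoeff_apply, constantCoeff_expSubst h0']
    simp
  have h := congrArg (coeff n) (derivative_expSubst h0')
  rw [coeff_derivative, Derivation.leibniz, derivative_C, smul_zero, add_zero, smul_eq_mul,
    mul_left_comm, coeff_C_mul, coeff_mul] at h
  rw [Nat.factorial_succ, Nat.cast_mul, Nat.cast_succ, mul_right_comm, mul_comm _ (coeff _ _), h,
    mul_right_comm, mul_assoc, norm_mul]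
  have hpp : ‖-((p : ℚ_[p])⁻¹ * (p : ℚ_[p])⁻¹)‖ = (p : ℝ) ^ 2 := by
    rw [norm_neg, norm_mul, norm_inv, Padic.norm_p, inv_inv, sq]
  rw [hpp, mul_add, mul_one, add_comm, pow_add]
  refine mul_le_mul_of_nonneg_left ?_ (by positivity)
  rw [Finset.mul_sum]
  refine IsUltrametricDist.norm_sum_le_of_forall_le_of_nonneg (by positivity) fun x hx => ?_
  have hx1 : x.1 ≤ n := by
    have := Finset.HasAntidiagonal.mem_antidiagonal.1 hx
    omega
  obtain ⟨d, hd⟩ := Nat.factorial_dvd_factorial hx1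
  rw [hd, Nat.cast_mul, mul_right_comm, ← mul_assoc, norm_mul, norm_mul, mul_assoc]
  calc _ ≤ (p : ℝ) ^ (2 * x.1) * (1 * 1) := by
        refine mul_le_mul (ih x.1 (by omega)) (mul_le_mul ?_ ?_ (norm_nonneg _) zero_le_one)
          (by positivity) (by positivity)
        · exact norm_coeff_derivative_artinHasseLog_le p x.2
        · exact_mod_cast Padic.norm_int_le_one (d : ℤ)
    _ ≤ _ := by
        rw [mul_one, mul_one]
        exact pow_le_pow_right₀ hp1 (by omega)

theorem dworkExp_eq_mul_expand : dworkExp p = expSubst (artinHasseLog p) *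
    expand p hp.out.ne_zero (expand p hp.out.ne_zero
      (expSubst (C (-((p : ℚ_[p])⁻¹ * (p : ℚ_[p])⁻¹)) * artinHasseLog p))) := by
  have h0 := constantCoeff_artinHasseLog p
  rw [expand_expSubst (by simp [h0]), expand_expSubst (by simp [h0]),
    ← expSubst_add h0 (by simp [h0]), dworkExp]
  congr 1
  have h1 := artinHasseLog_eq p
  have h2 := congrArg (expand p hp.out.ne_zero) h1
  rw [map_add, map_mul, expand_C, expand_X] at h2
  rw [h2] at h1
  simp only [map_mul, expand_C, map_neg]
  have h3 : artinHasseLog p = X + C (p : ℚ_[p])⁻¹ * X ^ p + C ((p : ℚ_[p])⁻¹ * (p : ℚ_[p])⁻¹) *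
      expand p hp.out.ne_zero (expand p hp.out.ne_zero (artinHasseLog p)) := by
    rw [map_mul]
    linear_combination h1
  rw [map_mul] at h3
  linear_combination -h3

variable {p} {σ : ℝ}

theorem norm_coeff_expSubst_neg_artinHasseLog_le_pow (n : ℕ) :
    ‖coeff n (expSubst (C (-((p : ℚ_[p])⁻¹ * (p : ℚ_[p])⁻¹)) * artinHasseLog p))‖ ≤
      (p : ℝ) ^ (3 * n) := by
  have h := norm_coeff_expSubst_neg_artinHasseLog_le p n
  have hp0 : (0 : ℝ) < p := by exact_mod_cast hp.out.pos
  have hp1 : (1 : ℝ) ≤ p := by exact_mod_cast hp.out.one_le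
  rw [norm_mul, Padic.norm_factorial, inv_pow, inv_mul_le_iff₀ (by positivity)] at h
  refine h.trans ?_
  rw [← pow_add]
  refine pow_le_pow_right₀ hp1 ?_
  have h1 := sub_one_mul_padicValNat_factorial (p := p) n
  have h2 : padicValNat p n.factorial ≤ (p - 1) * padicValNat p n.factorial :=
    Nat.le_mul_of_pos_left _ (Nat.sub_pos_of_lt hp.out.one_lt)
  omega

theorem norm_coeff_dworkExp_mul_pow_le (hp3 : 3 < p) (hσ0 : 0 < σ)
    (hσ : σ ^ (2 * (p - 1)) = (p : ℝ)⁻¹) (n : ℕ) :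
    ‖coeff n (dworkExp p)‖ * σ ^ n ≤ 1 := by
  have hp0 : (0 : ℝ) < p := by exact_mod_cast hp.out.pos
  have hp1 : (1 : ℝ) ≤ p := by exact_mod_cast hp.out.one_le
  have hσ1 : σ ≤ 1 := by
    by_contra! hσ1
    have h1 := one_lt_pow₀ hσ1 (n := 2 * (p - 1)) (by omega)
    rw [hσ] at h1
    exact absurd (inv_le_one_of_one_le₀ hp1) (not_le.2 h1)
  have key : ∀ k, ‖coeff k (expand p hp.out.ne_zero (expand p hp.out.ne_zero
      (expSubst (C (-((p : ℚ_[p])⁻¹ * (p : ℚ_[p])⁻¹)) * artinHasseLog p))))‖ ≤ (σ ^ k)⁻¹ := by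
    intro k
    rw [coeff_expand]
    split_ifs with h1
    · rw [coeff_expand]
      split_ifs with h2
      · obtain ⟨l, rfl⟩ := h1
        rw [Nat.mul_div_cancel_left l hp.out.pos] at h2 ⊢
        obtain ⟨l, rfl⟩ := h2
        rw [Nat.mul_div_cancel_left l hp.out.pos]
        refine (norm_coeff_expSubst_neg_artinHasseLog_le_pow l).trans ?_
        have h3 : (p : ℝ) ^ (3 * l) = ((σ ^ (2 * (p - 1) * (3 * l))))⁻¹ := by
          rw [pow_mul σ, hσ, inv_pow, inv_inv]
        rw [h3]
        refine inv_anti₀ (by positivity) (pow_le_pow_of_le_one hσ0.le hσ1 ?_)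
        obtain ⟨q, hq⟩ := Nat.exists_eq_add_of_lt hp3
        have h4 : p - 1 = 3 + q := by omega
        have : 6 * (p - 1) ≤ p * p := by
          rcases q with _ | q
          · exact absurd hp.out (by rw [hq]; decide)
          · rw [h4, hq]
            nlinarith
        calc 2 * (p - 1) * (3 * l) = 6 * (p - 1) * l := by ring
          _ ≤ p * p * l := Nat.mul_le_mul_right l this
          _ = _ := by ring
      · rw [norm_zero]
        positivity
    · rw [norm_zero]
      positivity
  rw [← le_div_iff₀ (by positivity), one_div, dworkExp_eq_mul_expand, coeff_mul]
  refine IsUltrametricDist.norm_sum_le_of_forall_le_of_nonneg (by positivity) fun x hx => ?_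
  rw [norm_mul]
  calc _ ≤ 1 * (σ ^ x.2)⁻¹ := mul_le_mul (norm_coeff_expSubst_artinHasseLog_le p _) (key _)
        (norm_nonneg _) zero_le_one
    _ ≤ _ := by
      rw [one_mul]
      refine inv_anti₀ (by positivity) (pow_le_pow_of_le_one hσ0.le hσ1 ?_)
      have := Finset.HasAntidiagonal.mem_antidiagonal.1 hx
      omega

end Dwork

section Dwork

open PowerSeries

variable {p : ℕ} [hp : Fact p.Prime]

theorem Padic.exists_root_norm (hp3 : 3 < p) :
    ∃ σ : ℝ, 0 < σ ∧ σ < 1 ∧ σ ^ (2 * (p - 1)) = (p : ℝ)⁻¹ := by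
  have hp1 : (1 : ℝ) < p := by exact_mod_cast hp.out.one_lt
  have hp0 : (0 : ℝ) < (p : ℝ)⁻¹ := by positivity
  have h0 : 2 * (p - 1) ≠ 0 := by omega
  refine ⟨(p : ℝ)⁻¹ ^ (((2 * (p - 1) : ℕ) : ℝ)⁻¹), Real.rpow_pos_of_pos hp0 _, ?_,
    Real.rpow_inv_natCast_pow hp0.le h0⟩
  exact Real.rpow_lt_one hp0.le (inv_lt_one_of_one_lt₀ hp1) (by positivity)

theorem norm_pow_mul_coeff_dworkExp_le {σ : ℝ} (hp3 : 3 < p) (hσ0 : 0 < σ) (hσ1 : σ < 1)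
    (hσ : σ ^ (2 * (p - 1)) = (p : ℝ)⁻¹) {n m K : ℕ} (hn : n ≤ K + p * m) :
    ‖(p : ℚ_[p]) ^ m * coeff n (dworkExp p)‖ ≤ (σ ^ K)⁻¹ * σ ^ m := by
  have h := norm_coeff_dworkExp_mul_pow_le hp3 hσ0 hσ n
  rw [← le_div_iff₀ (by positivity), one_div] at h
  rw [norm_mul, norm_pow, Padic.norm_p, ← hσ, ← pow_mul]
  calc _ ≤ σ ^ (2 * (p - 1) * m) * (σ ^ (K + p * m))⁻¹ := by
        refine mul_le_mul_of_nonneg_left (h.trans ?_) (by positivity)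
        exact inv_anti₀ (by positivity) (pow_le_pow_of_le_one hσ0.le hσ1.le hn)
    _ = (σ ^ K)⁻¹ * σ ^ ((p - 2) * m) := by
        obtain ⟨q, rfl⟩ := Nat.exists_eq_add_of_lt hp3
        rw [show 3 + q + 1 - 1 = q + 3 by omega, show 3 + q + 1 - 2 = q + 2 by omega]
        field_simp
        rw [← pow_add]
        ring_nf
    _ ≤ _ := by
        refine mul_le_mul_of_nonneg_left ?_ (by positivity)
        refine pow_le_pow_of_le_one hσ0.le hσ1.le (Nat.le_mul_of_pos_left _ (by omega))

/-- Morita's `p`-adic gamma function, characterized by continuity and its values at naturals. -/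
structure IsPadicGamma (Γ : ℤ_[p] → ℤ_[p]) : Prop where
  continuous : Continuous Γ
  zero : Γ 0 = 1
  natCast : ∀ m : ℕ, 0 < m →
    Γ (m : ℤ_[p]) = (-1) ^ m * ∏ k ∈ (Finset.Ico 1 m).filter (fun k => ¬ p ∣ k), (k : ℤ_[p])

theorem PadicInt.isUnit_natCast_iff {n : ℕ} : IsUnit (n : ℤ_[p]) ↔ ¬ p ∣ n := by
  rw [PadicInt.isUnit_iff, ← not_iff_not, not_not, ← PadicInt.norm_natCast_lt_one_iff]
  exact ⟨fun h => lt_of_le_of_ne (PadicInt.norm_le_one _) h, fun h => h.ne⟩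

theorem PadicInt.continuous_ite_isUnit {X : Type*} [TopologicalSpace X] {f g : ℤ_[p] → X}
    (hf : Continuous f) (hg : Continuous g) [DecidablePred fun x : ℤ_[p] => IsUnit x] :
    Continuous fun x => if IsUnit x then f x else g x := by
  refine hf.if (fun x hx => ?_) hg
  have h : {x : ℤ_[p] | IsUnit x} = Metric.sphere 0 1 := by
    ext x
    simp [PadicInt.isUnit_iff]
  rw [h, (IsUltrametricDist.isClopen_sphere (0 : ℤ_[p]) one_ne_zero).frontier_eq] at hx
  exact hx.elim

theorem PadicInt.denseRange_neg_natCast : DenseRange fun n : ℕ => -(n : ℤ_[p]) :=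
  (Homeomorph.neg ℤ_[p]).surjective.denseRange.comp PadicInt.denseRange_natCast
    (Homeomorph.neg ℤ_[p]).continuous

open Classical in
theorem IsPadicGamma.add_one {Γ : ℤ_[p] → ℤ_[p]} (hΓ : IsPadicGamma Γ) (x : ℤ_[p]) :
    Γ (x + 1) = if IsUnit x then -x * Γ x else -Γ x := by
  have hc := hΓ.continuous
  refine congrFun (PadicInt.denseRange_natCast.equalizer (hc.comp (continuous_add_const 1))
    (PadicInt.continuous_ite_isUnit (continuous_neg.mul hc) hc.neg) (funext fun n => ?_)) x
  simp only [Function.comp_apply, PadicInt.isUnit_natCast_iff, Pi.mul_apply, Pi.neg_apply]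
  rcases Nat.eq_zero_or_pos n with rfl | hn
  · have := hΓ.natCast 1 one_pos
    simpa [hΓ.zero] using this
  · have h1 := hΓ.natCast (n + 1) n.succ_pos
    rw [Nat.cast_succ] at h1
    rw [h1, hΓ.natCast n hn, ← Finset.insert_Ico_right_eq_Ico_add_one hn, Finset.filter_insert]
    split_ifs with hpn
    · ring
    · rw [Finset.prod_insert (by simp)]
      ring

theorem IsPadicGamma.norm_eq_one {Γ : ℤ_[p] → ℤ_[p]} (hΓ : IsPadicGamma Γ) (x : ℤ_[p]) :
    ‖Γ x‖ = 1 := by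
  refine congrFun (PadicInt.denseRange_natCast.equalizer hΓ.continuous.norm
    (continuous_const (y := (1 : ℝ))) (funext fun n => ?_)) x
  simp only [Function.comp_apply]
  induction n with
  | zero => simp [hΓ.zero]
  | succ n ih =>
    rw [Nat.cast_succ, hΓ.add_one]
    split_ifs with h
    · rw [norm_mul, norm_neg, ih, PadicInt.isUnit_iff.1 h, one_mul]
    · rw [norm_neg, ih]

theorem IsPadicGamma.neg_natCast_mul_factorial {Γ : ℤ_[p] → ℤ_[p]} (hΓ : IsPadicGamma Γ) (n : ℕ) :
    Γ (-n) * n.factorial = (-p) ^ (n / p) * (n / p).factorial := by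
  induction n with
  | zero => simp [hΓ.zero]
  | succ n ih =>
    have h := hΓ.add_one (-(n + 1 : ℕ))
    rw [show (-(n + 1 : ℕ) : ℤ_[p]) + 1 = -n by push_cast; ring] at h
    simp only [IsUnit.neg_iff, PadicInt.isUnit_natCast_iff] at h
    rw [Nat.succ_div]
    by_cases hpn : p ∣ n + 1
    · rw [if_neg (not_not.2 hpn)] at h
      rw [if_pos hpn, Nat.factorial_succ, Nat.factorial_succ, pow_succ]
      have h1 : ((n + 1 : ℕ) : ℤ_[p]) = p * (n / p + 1 : ℕ) := by
        have h2 : (n + 1) / p = n / p + 1 := by rw [Nat.succ_div, if_pos hpn]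
        rw [← Nat.cast_mul, ← h2, Nat.mul_div_cancel' hpn]
      rw [h] at ih
      generalize Γ (-(n + 1 : ℕ)) = g at ih ⊢
      rw [Nat.cast_mul, Nat.cast_mul, h1]
      linear_combination (-(p * (n / p + 1 : ℕ) : ℤ_[p])) * ih
    · rw [if_pos hpn, neg_neg] at h
      rw [if_neg hpn, add_zero, Nat.factorial_succ, ← ih, h]
      push_cast
      ring

theorem prod_range_neg_natCast_add {R : Type*} [CommRing R] (N m : ℕ) :
    ∏ i ∈ Finset.range m, (-(N : R) + i) = (-1) ^ m * N.descFactorial m := by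
  induction m with
  | zero => simp
  | succ m ih =>
    rw [Finset.prod_range_succ, ih, Nat.descFactorial_succ, Nat.cast_mul, pow_succ]
    rcases le_or_gt m N with h | h
    · rw [Nat.cast_sub h]
      ring
    · simp [Nat.descFactorial_of_lt h]

theorem PadicInt.norm_prod_range_add_le_one (z : ℤ_[p]) (m : ℕ) :
    ‖∏ i ∈ Finset.range m, ((z : ℚ_[p]) + i)‖ ≤ 1 := by
  rw [norm_prod]
  refine Finset.prod_le_one (fun _ _ => norm_nonneg _) fun i _ => ?_
  have := PadicInt.norm_le_one (z + (i : ℤ_[p]))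
  rwa [PadicInt.norm_def, PadicInt.coe_add, PadicInt.coe_natCast] at this

/-- Dwork's expansion of the `p`-adic gamma function on a residue disc. -/
theorem IsPadicGamma.eq_tsum {Γ : ℤ_[p] → ℤ_[p]} (hΓ : IsPadicGamma Γ) (hp3 : 3 < p) {a : ℕ}
    (ha : a < p) (z : ℤ_[p]) :
    (Γ (-a + p * z) : ℚ_[p]) = ∑' m : ℕ, (p : ℚ_[p]) ^ m * coeff (a + p * m) (dworkExp p) *
      ∏ i ∈ Finset.range m, ((z : ℚ_[p]) + i) := by
  obtain ⟨σ, hσ0, hσ1, hσ⟩ := Padic.exists_root_norm hp3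
  refine congrFun (DenseRange.equalizer (g := fun z : ℤ_[p] => (Γ (-a + p * z) : ℚ_[p]))
    (h := fun z : ℤ_[p] => ∑' m : ℕ, (p : ℚ_[p]) ^ m * coeff (a + p * m) (dworkExp p) *
      ∏ i ∈ Finset.range m, ((z : ℚ_[p]) + i))
    PadicInt.denseRange_neg_natCast ?_ ?_ (funext fun N => ?_)) z
  · exact continuous_subtype_val.comp (hΓ.continuous.comp (by fun_prop))
  · refine continuous_tsum (u := fun m => (σ ^ a)⁻¹ * σ ^ m) (fun m => ?_) ?_ fun m z => ?_
    · have : Continuous fun z : ℤ_[p] => (z : ℚ_[p]) := continuous_subtype_val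
      fun_prop
    · exact (summable_geometric_of_lt_one hσ0.le hσ1).mul_left _
    · rw [norm_mul]
      calc _ ≤ (σ ^ a)⁻¹ * σ ^ m * 1 := by
            refine mul_le_mul (norm_pow_mul_coeff_dworkExp_le hp3 hσ0 hσ1 hσ le_rfl)
              (PadicInt.norm_prod_range_add_le_one z m) (norm_nonneg _) (by positivity)
        _ = _ := mul_one _
  · simp only [Function.comp_apply]
    have hp0 : (p : ℚ_[p]) ≠ 0 := by exact_mod_cast hp.out.ne_zero
    have h1 := congrArg (fun x : ℤ_[p] => (x : ℚ_[p])) (hΓ.neg_natCast_mul_factorial (a + p * N))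
    rw [Nat.add_mul_div_left _ _ hp.out.pos, Nat.div_eq_of_lt ha, zero_add] at h1
    push_cast at h1
    have hf : ((a + p * N).factorial : ℚ_[p]) ≠ 0 := by exact_mod_cast Nat.factorial_ne_zero _
    rw [show (-a + p * -N : ℤ_[p]) = -(a + p * N) by ring, eq_div_of_mul_eq hf h1, div_eq_mul_one_div,
      ← sum_coeff_dworkExp_mul p a N ha, tsum_eq_sum (s := Finset.range (N + 1)),
      ← Finset.sum_range_reflect, Finset.mul_sum]
    · refine Finset.sum_congr rfl fun m hm => ?_
      have hm' : m ≤ N := Nat.lt_succ_iff.1 (Finset.mem_range.1 hm)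
      push_cast
      rw [prod_range_neg_natCast_add,
        show N - (N - m) = m by omega]
      have h2 := Nat.factorial_mul_descFactorial hm'
      have h3 : (((N - m).factorial : ℕ) : ℚ_[p]) ≠ 0 := by exact_mod_cast Nat.factorial_ne_zero _
      rw [← h2]
      obtain ⟨k, rfl⟩ := Nat.exists_eq_add_of_le hm'
      rw [Nat.add_sub_cancel_left] at h3 ⊢
      push_cast
      rw [← neg_one_mul (p : ℚ_[p]), ← neg_one_mul (p : ℚ_[p])⁻¹, mul_pow, mul_pow, inv_pow]
      field_simp
      have h4 : ((-1 : ℚ_[p]) ^ k) ^ 2 = 1 := by rw [← pow_mul, mul_comm, pow_mul]; simp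
      rw [pow_add, pow_add]
      linear_combination (p ^ m * p ^ k * (coeff (a + p * m)) (dworkExp p) * (-1) ^ m : ℚ_[p]) * h4
    · intro m hm
      have hm' : N < m := by
        rw [Finset.mem_range] at hm
        omega
      push_cast
      rw [prod_range_neg_natCast_add, Nat.descFactorial_of_lt hm']
      simp

end Dwork

section Dwork

open PowerSeries

variable {p : ℕ} [hp : Fact p.Prime]

/-- The matrix of Dwork's operator attached to `dworkExp p` on the exponents congruent to `-j`. -/
noncomputable def dworkMatrix (p : ℕ) [Fact p.Prime] (j m n : ℕ) : ℚ_[p] :=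
  (-(p : ℚ_[p])) ^ m * if n ≤ j + p * m then coeff (j + p * m - n) (dworkExp p) else 0

theorem norm_dworkMatrix_le {σ : ℝ} (hp3 : 3 < p) (hσ0 : 0 < σ) (hσ1 : σ < 1)
    (hσ : σ ^ (2 * (p - 1)) = (p : ℝ)⁻¹) (j m n : ℕ) :
    ‖dworkMatrix p j m n‖ ≤ (σ ^ j)⁻¹ * σ ^ m := by
  rw [dworkMatrix]
  split_ifs
  · rw [norm_mul, norm_pow, norm_neg, ← norm_pow, ← norm_mul]
    exact norm_pow_mul_coeff_dworkExp_le hp3 hσ0 hσ1 hσ (Nat.sub_le _ _)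
  · rw [mul_zero, norm_zero]
    positivity

theorem dworkMatrix_diag {j m : ℕ} :
    dworkMatrix p j m m = (-(p : ℚ_[p])) ^ m * coeff (j + (p - 1) * m) (dworkExp p) := by
  have h : m ≤ p * m := Nat.le_mul_of_pos_left _ hp.out.pos
  rw [dworkMatrix, if_pos (by omega), Nat.sub_mul, one_mul, Nat.add_sub_assoc h]

theorem dworkMatrix_succ_add {j : ℕ} (m n : ℕ) {z : ℚ_[p]} (hz : (p - 1) * z = j) :
    dworkMatrix p j (m + 1) (n + 1) + (z + n) * dworkMatrix p j (m + 1) n =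
      p * ((z + (m + 1 : ℕ)) * dworkMatrix p j (m + 1) n + dworkMatrix p j m n) := by
  simp only [dworkMatrix]
  have hp1 := hp.out.pos
  rcases lt_trichotomy n (j + p * (m + 1)) with h | h | h
  · obtain ⟨k, hk⟩ := Nat.exists_eq_add_of_lt h
    have h1 := succ_mul_coeff_dworkExp_succ p k
    have hk2 : j + p * m + p = n + k + 1 := by rw [← hk]; ring
    have hk3 : (j : ℚ_[p]) + p * m + p = n + k + 1 := by exact_mod_cast hk2
    rw [hk, if_pos (by omega), if_pos (by omega), show n + k + 1 - (n + 1) = k by omega,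
      show n + k + 1 - n = k + 1 by omega]
    by_cases h2 : p ≤ k + 1
    · rw [if_pos h2] at h1
      rw [if_pos (by omega), show j + p * m - n = k + 1 - p by omega]
      push_cast
      rw [pow_succ]
      linear_combination ((-(p : ℚ_[p])) ^ m * (-p) * coeff (k + 1) (dworkExp p)) * (-hz - hk3) -
        ((-(p : ℚ_[p])) ^ m * (-p)) * h1
    · rw [if_neg h2] at h1
      rw [if_neg (by omega)]
      push_cast
      rw [pow_succ]
      linear_combination ((-(p : ℚ_[p])) ^ m * (-p) * coeff (k + 1) (dworkExp p)) * (-hz - hk3) -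
        ((-(p : ℚ_[p])) ^ m * (-p)) * h1
  · have h1 : (n : ℚ_[p]) = j + p * (m + 1) := by exact_mod_cast h
    have h2 : n = j + p * m + p := by rw [h]; ring
    rw [if_neg (by omega), if_pos (by omega), if_neg (by omega)]
    push_cast
    linear_combination ((-(p : ℚ_[p])) ^ (m + 1) * coeff (j + p * (m + 1) - n) (dworkExp p)) *
      (h1 - hz)
  · have h2 : j + p * m + p < n := lt_of_eq_of_lt (by ring) h
    rw [if_neg (by omega), if_neg (by omega), if_neg (by omega)]
    ring

theorem summable_dworkMatrix_diag (hp3 : 3 < p) (j : ℕ) :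
    Summable fun m => dworkMatrix p j m m := by
  obtain ⟨σ, hσ0, hσ1, hσ⟩ := Padic.exists_root_norm hp3
  exact Summable.of_norm_bounded ((summable_geometric_of_lt_one hσ0.le hσ1).mul_left _)
    fun m => norm_dworkMatrix_le hp3 hσ0 hσ1 hσ j m m

/-- The trace of Dwork's operator. -/
theorem one_sub_mul_tsum_dworkMatrix (hp3 : 3 < p) {j : ℕ} {z : ℤ_[p]}
    (hz : (p - 1) * z = j) :
    (1 - p : ℚ_[p]) * ∑' m, dworkMatrix p j m m =
      ∑' m : ℕ, (p : ℚ_[p]) ^ m * coeff (j + p * m) (dworkExp p) *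
        ∏ i ∈ Finset.range m, ((z : ℚ_[p]) + i) := by
  obtain ⟨σ, hσ0, hσ1, hσ⟩ := Padic.exists_root_norm hp3
  have hz' : ((p : ℚ_[p]) - 1) * (z : ℚ_[p]) = j := by exact_mod_cast congrArg Subtype.val hz
  set φ := dworkMatrix p j with hφ
  have hφn : ∀ m n, ‖φ m n‖ ≤ (σ ^ j)⁻¹ * σ ^ m := norm_dworkMatrix_le hp3 hσ0 hσ1 hσ j
  set c : ℕ → ℕ → ℚ_[p] := fun i k => (-1) ^ k * ∏ l ∈ Finset.range k, ((z : ℚ_[p]) + i + l) with hc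
  have hzn : ∀ i : ℕ, ‖(z : ℚ_[p]) + i‖ ≤ 1 := fun i => by
    have := PadicInt.norm_le_one (z + (i : ℤ_[p]))
    rwa [PadicInt.norm_def, PadicInt.coe_add, PadicInt.coe_natCast] at this
  have hcn : ∀ i k, ‖c i k‖ ≤ 1 := fun i k => by
    have := PadicInt.norm_prod_range_add_le_one (z + (i : ℤ_[p])) k
    rw [PadicInt.coe_add, PadicInt.coe_natCast] at this
    simpa [hc] using this
  have hc0 : ∀ i, c i 0 = 1 := fun i => by simp [hc]
  have hc1 : ∀ i k, c i (k + 1) = -(z + i) * c (i + 1) k := fun i k => by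
    simp only [hc]
    rw [Finset.prod_range_succ', pow_succ]
    push_cast
    simp only [add_assoc, add_comm (1 : ℚ_[p])]
    ring
  have hc2 : ∀ i k, c i (k + 1) = -(z + i + k) * c i k := fun i k => by
    simp only [hc]
    rw [Finset.prod_range_succ, pow_succ]
    ring
  have hbd : ∀ i k m n, ‖c i k * φ (m + k) n‖ ≤ (σ ^ j)⁻¹ * σ ^ m * σ ^ k := fun i k m n => by
    rw [norm_mul, mul_assoc, ← pow_add]
    exact (mul_le_of_le_one_left (norm_nonneg _) (hcn i k)).trans (hφn _ _)
  have hgeo : ∀ C : ℝ, Summable fun k : ℕ => C * σ ^ k := fun C =>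
    (summable_geometric_of_lt_one hσ0.le hσ1).mul_left _
  have hsum : ∀ i m n, Summable fun k => c i k * φ (m + k) n := fun i m n =>
    Summable.of_norm_bounded (hgeo _) fun k => hbd i k m n
  set Y : ℕ → ℕ → ℚ_[p] := fun i n => ∑' k, c i k * φ (i + k) n with hY
  have hYn : ∀ i n, ‖Y i n‖ ≤ (σ ^ j)⁻¹ * σ ^ i := fun i n => by
    refine IsUltrametricDist.norm_tsum_le_of_forall_le_of_nonneg (by positivity) fun k => ?_
    exact (hbd i k i n).trans (mul_le_of_le_one_right (by positivity) (pow_le_one₀ hσ0.le hσ1.le))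
  have hY1 : ∀ i n, Y i n + (z + i) * Y (i + 1) n = φ i n := fun i n => by
    simp only [hY]
    rw [(hsum i i n).tsum_eq_zero_add, hc0, one_mul, add_zero, ← tsum_mul_left, add_assoc,
      ← ((summable_nat_add_iff 1).2 (hsum i i n)).tsum_add ((hsum _ _ n).mul_left _)]
    rw [tsum_congr (g := fun _ => 0), tsum_zero, add_zero]
    intro k
    rw [hc1, show i + (k + 1) = i + 1 + k by ring]
    ring
  have hY2 : ∀ i n, (z + n) * Y (i + 1) n + Y (i + 1) (n + 1) = p * φ i n := fun i n => by
    have h1 : ∀ k, (z + n) * (c (i + 1) k * φ (i + 1 + k) n) + c (i + 1) k * φ (i + 1 + k) (n + 1) =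
        p * (c (i + 1) k * φ (i + k) n - c (i + 1) (k + 1) * φ (i + (k + 1)) n) := fun k => by
      have := dworkMatrix_succ_add (i + k) n hz'
      rw [← hφ] at this
      rw [show i + 1 + k = i + k + 1 by ring, show i + (k + 1) = i + k + 1 by ring, hc2]
      push_cast at this ⊢
      linear_combination c (i + 1) k * this
    have hs := hsum (i + 1) i n
    simp only [hY]
    rw [← tsum_mul_left, ← ((hsum _ _ n).mul_left _).tsum_add (hsum _ _ _), tsum_congr h1,
      tsum_mul_left, (hs).tsum_sub ((summable_nat_add_iff 1).2 hs),
      hs.tsum_eq_zero_add, hc0, one_mul, add_zero]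
    simp
  have hsY : ∀ f : ℕ → ℕ, Summable fun i => Y i (f i) := fun f =>
    Summable.of_norm_bounded (hgeo _) fun i => hYn i (f i)
  have hsY' : Summable fun i : ℕ => ((z : ℚ_[p]) + i) * Y (i + 1) i := by
    refine Summable.of_norm_bounded (hgeo ((σ ^ j)⁻¹ * σ)) fun i => ?_
    rw [norm_mul, mul_assoc, ← pow_succ']
    exact (mul_le_of_le_one_left (norm_nonneg _) (hzn i)).trans (hYn _ _)
  have e1 : ∑' i, Y i i + ∑' i : ℕ, ((z : ℚ_[p]) + i) * Y (i + 1) i = ∑' i, φ i i := by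
    rw [← (hsY fun i => i).tsum_add hsY']
    exact tsum_congr fun i => hY1 i i
  have e2 : ∑' i : ℕ, ((z : ℚ_[p]) + i) * Y (i + 1) i + ∑' i, Y (i + 1) (i + 1) =
      p * ∑' i, φ i i := by
    rw [← tsum_mul_left, ← hsY'.tsum_add ((summable_nat_add_iff 1).2 (hsY fun i => i))]
    exact tsum_congr fun i => hY2 i i
  have e3 := (hsY fun i => i).tsum_eq_zero_add
  have e4 : Y 0 0 = ∑' m : ℕ, (p : ℚ_[p]) ^ m * coeff (j + p * m) (dworkExp p) *
        ∏ i ∈ Finset.range m, ((z : ℚ_[p]) + i) := by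
    refine tsum_congr fun m => ?_
    simp only [hc, hφ, dworkMatrix, zero_add, if_pos (Nat.zero_le _), Nat.sub_zero, Nat.cast_zero,
      add_zero]
    rw [← neg_one_mul (p : ℚ_[p]), mul_pow]
    have h4 : ((-1 : ℚ_[p]) ^ m) ^ 2 = 1 := by rw [← pow_mul, mul_comm, pow_mul]; simp
    linear_combination (p ^ m * coeff (j + p * m) (dworkExp p) *
        ∏ i ∈ Finset.range m, ((z : ℚ_[p]) + i) : ℚ_[p]) * h4
  rw [← e4]
  linear_combination e2 - e1 + e3

theorem IsPadicGamma.one_sub_mul_tsum_dworkMatrix {Γ : ℤ_[p] → ℤ_[p]} (hΓ : IsPadicGamma Γ)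
    (hp3 : 3 < p) {j : ℕ} (hj : j < p) {z : ℤ_[p]} (hz : (p - 1) * z = j) :
    (1 - p : ℚ_[p]) * ∑' m, dworkMatrix p j m m = Γ z := by
  rw [_root_.one_sub_mul_tsum_dworkMatrix hp3 hz, ← hΓ.eq_tsum hp3 hj,
    show -(j : ℤ_[p]) + p * z = z by linear_combination hz]

end Dwork

section Evaluation

open PowerSeries

variable {p : ℕ} [hp : Fact p.Prime] {K : Type*} [NormedField K] [NormedAlgebra ℚ_[p] K]

/-- Absolute convergence of the power series `f` at `x`. -/
def PowerSeries.AbsConvergesAt (x : K) (f : ℚ_[p]⟦X⟧) : Prop :=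
  Summable fun n => ‖algebraMap ℚ_[p] K (coeff n f) * x ^ n‖

/-- The value of the power series `f` at `x`. -/
noncomputable def PowerSeries.tsumEval (x : K) (f : ℚ_[p]⟦X⟧) : K :=
  ∑' n, algebraMap ℚ_[p] K (coeff n f) * x ^ n

theorem PowerSeries.tsumEval_one (x : K) : tsumEval x (1 : ℚ_[p]⟦X⟧) = 1 := by
  rw [tsumEval, tsum_eq_single 0 fun n hn => by rw [coeff_one, if_neg hn, map_zero, zero_mul]]
  simp

theorem PowerSeries.absConvergesAt_one (x : K) : AbsConvergesAt x (1 : ℚ_[p]⟦X⟧) := by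
  refine summable_of_ne_finset_zero (s := {0}) fun n hn => ?_
  rw [coeff_one, if_neg (by simpa using hn), map_zero, zero_mul, norm_zero]

theorem PowerSeries.sum_antidiagonal_eval (x : K) (f g : ℚ_[p]⟦X⟧) (n : ℕ) :
    ∑ kl ∈ Finset.HasAntidiagonal.antidiagonal n, algebraMap ℚ_[p] K (coeff kl.1 f) * x ^ kl.1 *
      (algebraMap ℚ_[p] K (coeff kl.2 g) * x ^ kl.2) =
      algebraMap ℚ_[p] K (coeff n (f * g)) * x ^ n := by
  rw [coeff_mul, map_sum, Finset.sum_mul]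
  refine Finset.sum_congr rfl fun kl h => ?_
  rw [← Finset.HasAntidiagonal.mem_antidiagonal.1 h, map_mul, pow_add]
  ring

theorem PowerSeries.AbsConvergesAt.mul {x : K} {f g : ℚ_[p]⟦X⟧} (hf : AbsConvergesAt x f)
    (hg : AbsConvergesAt x g) : AbsConvergesAt x (f * g) := by
  have := summable_norm_sum_mul_antidiagonal_of_summable_norm hf hg
  simp only [sum_antidiagonal_eval] at this
  exact this

theorem PowerSeries.tsumEval_mul [CompleteSpace K] {x : K} {f g : ℚ_[p]⟦X⟧}
    (hf : AbsConvergesAt x f) (hg : AbsConvergesAt x g) :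
    tsumEval x (f * g) = tsumEval x f * tsumEval x g := by
  have := tsum_mul_tsum_eq_tsum_sum_antidiagonal_of_summable_norm hf hg
  simp only [sum_antidiagonal_eval] at this
  exact this.symm

theorem PowerSeries.tsumEval_pow [CompleteSpace K] {x : K} {f : ℚ_[p]⟦X⟧}
    (hf : AbsConvergesAt x f) (n : ℕ) :
    AbsConvergesAt x (f ^ n) ∧ tsumEval x (f ^ n) = tsumEval x f ^ n := by
  induction n with
  | zero => simpa using ⟨absConvergesAt_one x, tsumEval_one x⟩
  | succ n ih =>
    rw [pow_succ, pow_succ]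
    exact ⟨ih.1.mul hf, by rw [tsumEval_mul ih.1 hf, ih.2]⟩

theorem PowerSeries.eval_expand_comp (x : K) (f : ℚ_[p]⟦X⟧) {n : ℕ} (hn : n ≠ 0) :
    (fun k => algebraMap ℚ_[p] K (coeff k (expand n hn f)) * x ^ k) ∘ (fun k => n * k) =
      fun k => algebraMap ℚ_[p] K (coeff k f) * (x ^ n) ^ k := by
  funext k
  simp only [Function.comp_apply]
  rw [coeff_expand, if_pos (dvd_mul_right _ _), Nat.mul_div_cancel_left _ (Nat.pos_of_ne_zero hn),
    pow_mul]

theorem PowerSeries.support_eval_expand (x : K) (f : ℚ_[p]⟦X⟧) {n : ℕ} (hn : n ≠ 0) :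
    ∀ k ∉ Set.range fun k => n * k,
      algebraMap ℚ_[p] K (coeff k (expand n hn f)) * x ^ k = 0 := by
  intro k hk
  rw [coeff_expand, if_neg, map_zero, zero_mul]
  rintro ⟨l, rfl⟩
  exact hk ⟨l, rfl⟩

theorem PowerSeries.tsumEval_expand (x : K) (f : ℚ_[p]⟦X⟧) {n : ℕ} (hn : n ≠ 0) :
    tsumEval x (expand n hn f) = tsumEval (x ^ n) f := by
  have hinj : Function.Injective fun k => n * k := fun a b h =>
    Nat.eq_of_mul_eq_mul_left (Nat.pos_of_ne_zero hn) h
  rw [tsumEval, ← hinj.tsum_eq (Function.support_subset_iff'.2 (support_eval_expand x f hn)),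
    tsumEval]
  exact tsum_congr (congrFun (eval_expand_comp x f hn))

theorem PowerSeries.absConvergesAt_expand {x : K} {f : ℚ_[p]⟦X⟧} {n : ℕ} (hn : n ≠ 0)
    (hf : AbsConvergesAt (x ^ n) f) : AbsConvergesAt x (expand n hn f) := by
  have hinj : Function.Injective fun k => n * k := fun a b h =>
    Nat.eq_of_mul_eq_mul_left (Nat.pos_of_ne_zero hn) h
  refine (hinj.summable_iff fun k hk => ?_).1 (hf.congr fun k => ?_)
  · rw [support_eval_expand x f hn k hk, norm_zero]
  · exact congrArg norm (congrFun (eval_expand_comp x f hn) k).symm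

theorem norm_natCast_prime : ‖(p : K)‖ = (p : ℝ)⁻¹ := by
  rw [← map_natCast (algebraMap ℚ_[p] K), norm_algebraMap', Padic.norm_p]

/-- A `p`-th root of unity close enough to `1` is `1`. -/
theorem eq_one_of_pow_prime_eq_one [IsUltrametricDist K] {r : K} (hr : r ^ p = 1) (h : ‖r - 1‖ ^ (p - 1) < (p : ℝ)⁻¹) :
    r = 1 := by
  by_contra hne
  set t := r - 1 with ht
  have ht0 : 0 < ‖t‖ := norm_pos_iff.2 (sub_ne_zero.2 hne)
  have hp1 := hp.out.one_lt
  have ht1 : ‖t‖ < 1 := by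
    by_contra! h1
    exact absurd (h.trans_le (inv_le_one_of_one_le₀ (by exact_mod_cast hp1.le)))
      (not_lt.2 (one_le_pow₀ h1))
  have h1 := add_pow_prime_eq hp.out t 1
  rw [ht, sub_add_cancel, hr, one_pow, ← ht] at h1
  rw [← Finset.add_sum_erase _ _ (Finset.mem_Ioo.2 ⟨one_pos, hp1⟩)] at h1
  set s := ∑ k ∈ (Finset.Ioo 0 p).erase 1, t ^ (k - 1) * 1 ^ (p - k - 1) * ((p.choose k / p : ℕ) : K) with hs
  have hs1 : ‖s‖ ≤ ‖t‖ ^ 1 := by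
    refine IsUltrametricDist.norm_sum_le_of_forall_le_of_nonneg (by positivity) fun k hk => ?_
    rw [one_pow, mul_one, norm_mul, norm_pow]
    have hk1 : 2 ≤ k := by
      rw [Finset.mem_erase, Finset.mem_Ioo] at hk
      omega
    exact (mul_le_of_le_one_right (by positivity) (IsUltrametricDist.norm_natCast_le_one K _)).trans
      (pow_le_pow_of_le_one ht0.le ht1.le (by omega))
  rw [pow_one] at hs1
  rw [Nat.choose_one_right, Nat.div_self hp.out.pos, one_pow, Nat.sub_self, pow_zero, mul_one,
    Nat.cast_one, mul_one, mul_one] at h1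
  have h2 : t ^ p = -(p * t * (1 + s)) := by linear_combination -h1
  have h3 : ‖1 + s‖ = 1 := by
    rw [IsUltrametricDist.norm_add_eq_max_of_norm_ne_norm, norm_one, max_eq_left (hs1.trans ht1.le)]
    rw [norm_one]
    exact (hs1.trans_lt ht1).ne'
  have h4 := congrArg norm h2
  rw [norm_neg, norm_mul, h3, norm_mul, norm_pow, norm_natCast_prime, mul_one] at h4
  have h5 : ‖t‖ ^ p = ‖t‖ ^ (p - 1) * ‖t‖ := by
    rw [← pow_succ, Nat.sub_add_cancel hp1.le]
  rw [h5] at h4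
  exact h.ne (mul_right_cancel₀ ht0.ne' h4)

theorem absConvergesAt_expSubst_C_mul_X {x : K} (hx : ‖x‖ < 1) {c : ℚ_[p]} (hc : c = p ∨ c = -p) :
    AbsConvergesAt x (expSubst (C c * X)) := by
  refine Summable.of_nonneg_of_le (fun _ => norm_nonneg _) (fun n => ?_)
    (summable_geometric_of_lt_one (norm_nonneg x) hx)
  rw [norm_mul, norm_pow, norm_algebraMap', coeff_expSubst_C_mul_X]
  refine mul_le_of_le_one_left (by positivity) ?_
  have h1 : ‖c ^ n / (n.factorial : ℚ_[p])‖ = ‖(p : ℚ_[p]) ^ n / n.factorial‖ := by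
    rcases hc with rfl | rfl
    · rfl
    · rw [norm_div, norm_pow, norm_neg, ← norm_pow, ← norm_div]
  rw [h1]
  rcases eq_or_ne n 0 with rfl | hn
  · simp
  · exact (Padic.norm_pow_div_factorial_le p hn).trans
      (inv_le_one_of_one_le₀ (by exact_mod_cast hp.out.one_le))

theorem tsumEval_neg_prime_mul (x : K) :
    (fun n => algebraMap ℚ_[p] K (coeff n (expSubst X)) * (-(p : K) * x) ^ n) =
      fun n => algebraMap ℚ_[p] K (coeff n (expSubst (C (-(p : ℚ_[p])) * X))) * x ^ n := by
  funext n
  have h := coeff_expSubst_C_mul_X (1 : ℚ_[p]) n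
  rw [map_one, one_mul] at h
  rw [h, coeff_expSubst_C_mul_X, mul_pow, map_div₀, map_div₀, one_pow, map_one, map_pow, map_neg,
    map_natCast, map_natCast]
  ring

theorem absConvergesAt_dworkExp {σ : ℝ} (hp3 : 3 < p) (hσ0 : 0 < σ) (hσ1 : σ < 1)
    (hσ : σ ^ (2 * (p - 1)) = (p : ℝ)⁻¹) {x : K} (hx : ‖x‖ ≤ σ ^ 2) :
    (∀ n, ‖algebraMap ℚ_[p] K (coeff n (dworkExp p)) * x ^ n‖ ≤ σ ^ n) ∧
      AbsConvergesAt x (dworkExp p) := by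
  have h : ∀ n, ‖algebraMap ℚ_[p] K (coeff n (dworkExp p)) * x ^ n‖ ≤ σ ^ n := fun n => by
    rw [norm_mul, norm_pow, norm_algebraMap']
    calc _ ≤ ‖coeff n (dworkExp p)‖ * (σ ^ 2) ^ n := by gcongr
      _ = ‖coeff n (dworkExp p)‖ * σ ^ n * σ ^ n := by ring
      _ ≤ _ := mul_le_of_le_one_left (by positivity) (norm_coeff_dworkExp_mul_pow_le hp3 hσ0 hσ n)
  exact ⟨h, Summable.of_nonneg_of_le (fun _ => norm_nonneg _) h
    (summable_geometric_of_lt_one hσ0.le hσ1)⟩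

variable [CompleteSpace K]

/-- At a solution of `x ^ p = -p * x`, Dwork's series takes a `p`-th root of unity as value. -/
theorem tsumEval_dworkExp_pow_prime {σ : ℝ} (hp3 : 3 < p) (hσ0 : 0 < σ) (hσ1 : σ < 1)
    (hσ : σ ^ (2 * (p - 1)) = (p : ℝ)⁻¹) {x : K} (hx : ‖x‖ ≤ σ ^ 2) (hxp : x ^ p = -p * x) :
    tsumEval x (dworkExp p) ^ p = 1 := by
  have hx1 : ‖x‖ < 1 := hx.trans_lt (pow_lt_one₀ hσ0.le hσ1 two_ne_zero)
  have h1 := absConvergesAt_expSubst_C_mul_X hx1 (c := (p : ℚ_[p])) (Or.inl rfl)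
  have h2 := absConvergesAt_expSubst_C_mul_X hx1 (c := -(p : ℚ_[p])) (Or.inr rfl)
  have h3 : AbsConvergesAt x (expand p hp.out.ne_zero (expSubst (X : ℚ_[p]⟦X⟧))) := by
    refine absConvergesAt_expand _ ?_
    rw [hxp]
    exact h2.congr fun n => congrArg norm (congrFun (tsumEval_neg_prime_mul x) n).symm
  rw [← (tsumEval_pow (absConvergesAt_dworkExp hp3 hσ0 hσ1 hσ hx).2 p).2, dworkExp_pow_prime,
    tsumEval_mul h1 h3, tsumEval_expand, hxp]
  have h4 : tsumEval (-(p : K) * x) (expSubst (X : ℚ_[p]⟦X⟧)) =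
      tsumEval x (expSubst (C (-(p : ℚ_[p])) * X)) :=
    tsum_congr (congrFun (tsumEval_neg_prime_mul x))
  rw [h4, ← tsumEval_mul h1 h2, ← expSubst_add (by simp) (by simp), ← add_mul, ← map_add,
    add_neg_cancel, map_zero, zero_mul, expSubst_zero, tsumEval_one]

variable [IsUltrametricDist K]

theorem norm_tsumEval_dworkExp_sub_le {σ : ℝ} (hp3 : 3 < p) (hσ0 : 0 < σ) (hσ1 : σ < 1)
    (hσ : σ ^ (2 * (p - 1)) = (p : ℝ)⁻¹) {x : K} (hx : ‖x‖ ≤ σ ^ 2) :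
    ‖tsumEval x (dworkExp p) - 1 - x‖ ≤ σ ^ 3 := by
  obtain ⟨h1, h2⟩ := absConvergesAt_dworkExp hp3 hσ0 hσ1 hσ hx
  have h3 := Summable.of_norm h2
  have e0 : coeff 1 (dworkExp p) = 1 := by simpa using coeff_dworkExp_of_lt p (n := 1) (by omega)
  have e1 := h3.sum_add_tsum_nat_add 2
  rw [Finset.sum_range_succ, Finset.sum_range_one, coeff_dworkExp_zero, e0, map_one, one_mul,
    pow_zero, pow_one, one_mul] at e1
  rw [tsumEval, ← e1, add_sub_right_comm, add_sub_cancel_left, add_sub_right_comm, sub_self, zero_add]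
  refine IsUltrametricDist.norm_tsum_le_of_forall_le_of_nonneg (by positivity) fun n => ?_
  rcases n with _ | n
  · rw [zero_add, coeff_dworkExp_of_lt p (n := 2) (by omega), norm_mul, norm_algebraMap', norm_pow]
    have h4 : ‖((1 : ℚ_[p]) / (Nat.factorial 2 : ℕ))‖ = 1 := by
      rw [norm_div, norm_one, Padic.norm_natCast_eq_one_iff.2, div_one]
      rw [Nat.factorial_two, Nat.coprime_primes hp.out Nat.prime_two]
      omega
    rw [h4, one_mul]
    calc ‖x‖ ^ 2 ≤ (σ ^ 2) ^ 2 := by gcongr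
      _ = σ ^ 4 := by ring
      _ ≤ _ := pow_le_pow_of_le_one hσ0.le hσ1.le (by norm_num)
  · exact (h1 _).trans (pow_le_pow_of_le_one hσ0.le hσ1.le (by omega))

end Evaluation

section Teichmuller

open PowerSeries

variable {p : ℕ} [hp : Fact p.Prime]

/-- The Teichmüller character, characterized by its reductions. -/
structure IsTeichmuller (ω : ZMod p → ℤ_[p]) : Prop where
  zero : ω 0 = 0
  mul : ∀ x y : ZMod p, ω (x * y) = ω x * ω y
  isUnit : ∀ x : ZMod p, x ≠ 0 → IsUnit (ω x)
  dvd_sub : ∀ x : ZMod p, (p : ℤ_[p]) ∣ (ω x - (x.val : ℤ_[p]))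

theorem IsTeichmuller.one {ω : ZMod p → ℤ_[p]} (hω : IsTeichmuller ω) : ω 1 = 1 := by
  have h := hω.mul 1 1
  rw [mul_one] at h
  exact (mul_right_cancel₀ (hω.isUnit 1 one_ne_zero).ne_zero (by rw [← h, one_mul])).symm

variable (K : Type*) [NormedField K] [NormedAlgebra ℚ_[p] K]

/-- The Teichmüller character as a multiplicative character with values in `K`. -/
noncomputable def teichChar {ω : ZMod p → ℤ_[p]} (hω : IsTeichmuller ω) : MulChar (ZMod p) K where
  toFun x := algebraMap ℚ_[p] K (ω x)
  map_one' := by simp [hω.one]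
  map_mul' x y := by simp [hω.mul]
  map_nonunit' x hx := by
    rw [isUnit_iff_ne_zero, not_not] at hx
    simp [hx, hω.zero]

variable {K} {ω : ZMod p → ℤ_[p]} (hω : IsTeichmuller ω)

theorem teichChar_apply (x : ZMod p) : teichChar K hω x = algebraMap ℚ_[p] K (ω x) := rfl

theorem norm_teichChar_sub_val_lt_one (x : ZMod p) : ‖teichChar K hω x - (x.val : K)‖ < 1 := by
  rw [teichChar_apply, ← map_natCast (algebraMap ℚ_[p] K), ← map_sub, norm_algebraMap']
  have := PadicInt.norm_lt_one_iff_dvd (ω x - (x.val : ℤ_[p]))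
  rw [PadicInt.norm_def] at this
  push_cast at this
  exact this.2 (hω.dvd_sub x)

theorem eq_one_of_teichChar_eq_one {x : ZMod p} (h : teichChar K hω x = 1) : x = 1 := by
  have h1 := hω.dvd_sub x
  rw [teichChar_apply] at h
  have h2 : ω x = 1 := by
    have := (algebraMap ℚ_[p] K).injective (h.trans (map_one _).symm)
    exact Subtype.ext this
  rw [h2] at h1
  have h3 : ((p : ℕ) : ℤ_[p]) ∣ ((1 - x.val : ℤ) : ℤ_[p]) := by exact_mod_cast h1
  have h4 := (PadicInt.norm_lt_one_iff_dvd _).2 h3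
  rw [PadicInt.norm_int_lt_one_iff_dvd] at h4
  have h5 := (ZMod.intCast_zmod_eq_zero_iff_dvd _ p).2 h4
  push_cast at h5
  rw [ZMod.natCast_val, ZMod.cast_id', id, sub_eq_zero] at h5
  exact h5.symm

theorem orderOf_teichChar : orderOf (teichChar K hω) = p - 1 := by
  refine Nat.dvd_antisymm ?_ ?_
  · refine orderOf_dvd_of_pow_eq_one (MulChar.ext fun u => ?_)
    rw [MulChar.pow_apply_coe, ← map_pow, ← Units.val_pow_eq_pow_val, ZMod.units_pow_card_sub_one_eq_one]
    simp
  · obtain ⟨g, hg⟩ := IsCyclic.exists_generator (α := (ZMod p)ˣ)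
    rw [← ZMod.card_units p, ← Nat.card_eq_fintype_card, ← orderOf_eq_card_of_forall_mem_zpowers hg]
    refine orderOf_dvd_of_pow_eq_one (Units.ext (eq_one_of_teichChar_eq_one (K := K) hω ?_))
    rw [Units.val_pow_eq_pow_val, map_pow, ← MulChar.pow_apply_coe, pow_orderOf_eq_one]
    exact MulChar.one_apply_coe g

theorem sum_teichChar_inv_pow_mul_pow (j n : ℕ) :
    ∑ x, ((teichChar K hω)⁻¹ ^ j * teichChar K hω ^ n) x =
      if n ≡ j [MOD p - 1] then (p : K) - 1 else 0 := by
  have h : (teichChar K hω)⁻¹ ^ j * teichChar K hω ^ n = 1 ↔ n ≡ j [MOD p - 1] := by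
    rw [inv_pow, inv_mul_eq_one, pow_eq_pow_iff_modEq, orderOf_teichChar]
    exact Nat.ModEq.comm
  split_ifs with h1
  · rw [h.2 h1, MulChar.sum_one_eq_card_units, ZMod.card_units, Nat.cast_sub hp.out.one_le,
      Nat.cast_one]
  · exact MulChar.sum_eq_zero_of_ne_one (mt h.1 h1)

theorem teichChar_pow_prime (x : ZMod p) : teichChar K hω x ^ p = teichChar K hω x := by
  rw [← map_pow, ZMod.pow_card]

theorem norm_teichChar_le_one (x : ZMod p) : ‖teichChar K hω x‖ ≤ 1 := by
  rw [teichChar_apply, norm_algebraMap']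
  exact PadicInt.norm_le_one _

end Teichmuller

theorem mul_pow_prime_of_pow_eq {p : ℕ} [hp : Fact p.Prime] {R : Type*} [CommRing R]
    {ϖ ζ : R} (hϖ : ϖ ^ (p - 1) = -p) (hζ : ζ ^ p = ζ) :
    (ϖ * ζ) ^ p = -p * (ϖ * ζ) := by
  have h1 : ϖ ^ p = ϖ ^ (p - 1) * ϖ := by rw [← pow_succ, Nat.sub_add_cancel hp.out.one_le]
  rw [mul_pow, hζ, h1, hϖ, mul_assoc]

section GaussSum

open PowerSeries

variable {p : ℕ} [hp : Fact p.Prime] {K : Type*} [NormedField K] [NormedAlgebra ℚ_[p] K]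

theorem norm_eq_of_pow_eq_neg_prime {σ : ℝ} (hσ0 : 0 < σ)
    (hσ : σ ^ (2 * (p - 1)) = (p : ℝ)⁻¹) {ϖ : K} (hϖ : ϖ ^ (p - 1) = -p) : ‖ϖ‖ = σ ^ 2 := by
  have h := congrArg norm hϖ
  rw [norm_pow, norm_neg, norm_natCast_prime, ← hσ, pow_mul] at h
  exact (pow_left_inj₀ (norm_nonneg _) (by positivity) (Nat.sub_pos_of_lt hp.out.one_lt).ne').1 h

variable [CompleteSpace K]

theorem tsumEval_dworkExp_pow_prime_eq_one (hp3 : 3 < p) {ϖ : K} (hϖ : ϖ ^ (p - 1) = -p) :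
    tsumEval ϖ (dworkExp p) ^ p = 1 := by
  obtain ⟨σ, hσ0, hσ1, hσ⟩ := Padic.exists_root_norm hp3
  have h := mul_pow_prime_of_pow_eq hϖ (one_pow p)
  rw [mul_one] at h
  exact tsumEval_dworkExp_pow_prime hp3 hσ0 hσ1 hσ (norm_eq_of_pow_eq_neg_prime hσ0 hσ hϖ).le h

variable [IsUltrametricDist K]

theorem tsumEval_dworkExp_mul (hp3 : 3 < p) {ϖ ζ : K} (hϖ : ϖ ^ (p - 1) = -p) (hζ : ζ ^ p = ζ)
    (hζ1 : ‖ζ‖ ≤ 1) {v : ℕ} (hv : ‖ζ - v‖ < 1) :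
    tsumEval (ϖ * ζ) (dworkExp p) = tsumEval ϖ (dworkExp p) ^ v := by
  obtain ⟨σ, hσ0, hσ1, hσ⟩ := Padic.exists_root_norm hp3
  have hϖn := norm_eq_of_pow_eq_neg_prime hσ0 hσ hϖ
  have hE := tsumEval_dworkExp_pow_prime_eq_one hp3 hϖ
  set E := tsumEval ϖ (dworkExp p) with hEdef
  have hE1 : ‖E‖ = 1 := by
    refine (pow_eq_one_iff_of_nonneg (norm_nonneg _) hp.out.ne_zero).1 ?_
    rw [← norm_pow, hE, norm_one]
  have hEs : ‖E - 1 - ϖ‖ ≤ σ ^ 3 := norm_tsumEval_dworkExp_sub_le hp3 hσ0 hσ1 hσ hϖn.le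
  have hσ43 : σ ^ 2 * σ ^ 2 ≤ σ ^ 3 := by
    rw [← pow_add]
    exact pow_le_pow_of_le_one hσ0.le hσ1.le (by norm_num)
  have hEv : ∀ v : ℕ, ‖E ^ v - 1 - v * ϖ‖ ≤ σ ^ 3 := fun v => by
    induction v with
    | zero => simp only [pow_zero, Nat.cast_zero, zero_mul, sub_self, norm_zero]; positivity
    | succ v ih =>
      have h1 : E ^ (v + 1) - 1 - (v + 1 : ℕ) * ϖ =
          E * (E ^ v - 1 - v * ϖ) + ((1 + v * ϖ) * (E - 1 - ϖ) + v * ϖ * ϖ) := by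
        push_cast
        ring
      have h2 : ‖(v : K) * ϖ‖ ≤ σ ^ 2 := by
        rw [norm_mul, hϖn]
        exact mul_le_of_le_one_left (by positivity) (IsUltrametricDist.norm_natCast_le_one K v)
      have h3 : ‖1 + (v : K) * ϖ‖ ≤ 1 := by
        refine (IsUltrametricDist.norm_add_le_max _ _).trans (max_le norm_one.le ?_)
        exact h2.trans (pow_le_one₀ hσ0.le hσ1.le)
      rw [h1]
      refine (IsUltrametricDist.norm_add_le_max _ _).trans (max_le ?_ ?_)
      · rw [norm_mul, hE1, one_mul]
        exact ih
      · refine (IsUltrametricDist.norm_add_le_max _ _).trans (max_le ?_ ?_)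
        · rw [norm_mul]
          exact (mul_le_of_le_one_left (norm_nonneg _) h3).trans hEs
        · rw [norm_mul, hϖn]
          exact (mul_le_mul_of_nonneg_right h2 (by positivity)).trans hσ43
  have hx : ‖ϖ * ζ‖ ≤ σ ^ 2 := by
    rw [norm_mul, hϖn]
    exact mul_le_of_le_one_right (by positivity) hζ1
  have h1 := norm_tsumEval_dworkExp_sub_le hp3 hσ0 hσ1 hσ hx
  have h2 := tsumEval_dworkExp_pow_prime hp3 hσ0 hσ1 hσ hx (mul_pow_prime_of_pow_eq hϖ hζ)
  set θ := tsumEval (ϖ * ζ) (dworkExp p) with hθ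
  have hEv0 : E ^ v ≠ 0 := by
    rw [← norm_pos_iff, norm_pow, hE1, one_pow]
    exact one_pos
  refine (div_eq_one_iff_eq hEv0).1 (eq_one_of_pow_prime_eq_one (p := p) ?_ ?_)
  · rw [div_pow, h2, ← pow_mul, mul_comm v, pow_mul, hE, one_pow, div_one]
  · have h3 : ‖θ / E ^ v - 1‖ < σ ^ 2 := by
      rw [div_sub_one hEv0, norm_div, norm_pow, hE1, one_pow, div_one]
      have h4 : θ - E ^ v = (θ - 1 - ϖ * ζ) + (-(E ^ v - 1 - v * ϖ) + ϖ * (ζ - v)) := by ring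
      have h5 : σ ^ 3 < σ ^ 2 := pow_lt_pow_right_of_lt_one₀ hσ0 hσ1 (by norm_num)
      rw [h4]
      refine (IsUltrametricDist.norm_add_le_max _ _).trans_lt (max_lt (h1.trans_lt h5) ?_)
      refine (IsUltrametricDist.norm_add_le_max _ _).trans_lt (max_lt ?_ ?_)
      · rw [norm_neg]
        exact (hEv v).trans_lt h5
      · rw [norm_mul, hϖn]
        exact mul_lt_of_lt_one_right (by positivity) hv
    rw [← hσ, pow_mul]
    exact pow_lt_pow_left₀ h3 (norm_nonneg _) (Nat.sub_pos_of_lt hp.out.one_lt).ne'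

theorem isPrimitiveRoot_tsumEval_dworkExp (hp3 : 3 < p) {ϖ : K} (hϖ : ϖ ^ (p - 1) = -p) :
    IsPrimitiveRoot (tsumEval ϖ (dworkExp p)) p := by
  obtain ⟨σ, hσ0, hσ1, hσ⟩ := Padic.exists_root_norm hp3
  have hϖn := norm_eq_of_pow_eq_neg_prime hσ0 hσ hϖ
  refine IsPrimitiveRoot.iff_orderOf.2
    (orderOf_eq_prime (tsumEval_dworkExp_pow_prime_eq_one hp3 hϖ) fun h => ?_)
  have h1 := norm_tsumEval_dworkExp_sub_le hp3 hσ0 hσ1 hσ hϖn.le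
  rw [h, sub_self, zero_sub, norm_neg, hϖn] at h1
  exact absurd h1 (not_le.2 (pow_lt_pow_right_of_lt_one₀ hσ0 hσ1 (by norm_num)))

/-- The additive character of `ZMod p` attached to a `(p - 1)`-th root of `-p`. -/
noncomputable def dworkChar (hp3 : 3 < p) {ϖ : K} (hϖ : ϖ ^ (p - 1) = -p) : AddChar (ZMod p) K :=
  AddChar.zmodChar p (tsumEval_dworkExp_pow_prime_eq_one hp3 hϖ)

theorem dworkChar_isPrimitive (hp3 : 3 < p) {ϖ : K} (hϖ : ϖ ^ (p - 1) = -p) :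
    (dworkChar hp3 hϖ).IsPrimitive :=
  AddChar.zmodChar_primitive_of_primitive_root p (isPrimitiveRoot_tsumEval_dworkExp hp3 hϖ)

theorem dworkChar_apply (hp3 : 3 < p) {ϖ : K} (hϖ : ϖ ^ (p - 1) = -p) {ω : ZMod p → ℤ_[p]}
    (hω : IsTeichmuller ω) (x : ZMod p) :
    dworkChar hp3 hϖ x = tsumEval (ϖ * teichChar K hω x) (dworkExp p) := by
  rw [dworkChar, AddChar.zmodChar_apply]
  exact (tsumEval_dworkExp_mul hp3 hϖ (teichChar_pow_prime hω x) (norm_teichChar_le_one hω x)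
    (norm_teichChar_sub_val_lt_one hω x)).symm

/-- The Gross–Koblitz formula over the prime field. -/
theorem IsPadicGamma.gaussSum_eq {Γ : ℤ_[p] → ℤ_[p]} (hΓ : IsPadicGamma Γ) (hp3 : 3 < p) {ϖ : K}
    (hϖ : ϖ ^ (p - 1) = -p) {ω : ZMod p → ℤ_[p]} (hω : IsTeichmuller ω) {j : ℕ} (hj : j < p - 1)
    {z : ℤ_[p]} (hz : (p - 1) * z = j) :
    gaussSum ((teichChar K hω)⁻¹ ^ j) (dworkChar hp3 hϖ) =
      -(ϖ ^ j * algebraMap ℚ_[p] K (Γ z)) := by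
  obtain ⟨σ, hσ0, hσ1, hσ⟩ := Padic.exists_root_norm hp3
  have hϖn := norm_eq_of_pow_eq_neg_prime hσ0 hσ hϖ
  set W := teichChar K hω with hW
  set b : ℕ → K := fun n => algebraMap ℚ_[p] K (coeff n (dworkExp p)) with hb
  have hsum : ∀ x : ZMod p, Summable fun n => (W⁻¹ ^ j) x * (b n * (ϖ * W x) ^ n) := fun x => by
    refine Summable.mul_left _ (Summable.of_norm (absConvergesAt_dworkExp hp3 hσ0 hσ1 hσ ?_).2)
    rw [norm_mul, hϖn]
    exact mul_le_of_le_one_right (by positivity) (norm_teichChar_le_one hω x)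
  have h1 : gaussSum (W⁻¹ ^ j) (dworkChar hp3 hϖ) =
      ∑' n, b n * ϖ ^ n * (if n ≡ j [MOD p - 1] then (p : K) - 1 else 0) := by
    rw [gaussSum]
    calc _ = ∑ x, ∑' n, (W⁻¹ ^ j) x * (b n * (ϖ * W x) ^ n) := by
          refine Finset.sum_congr rfl fun x _ => ?_
          rw [dworkChar_apply hp3 hϖ hω, tsumEval, tsum_mul_left]
      _ = ∑' n, ∑ x, (W⁻¹ ^ j) x * (b n * (ϖ * W x) ^ n) :=
          (Summable.tsum_finsetSum fun x _ => hsum x).symm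
      _ = _ := by
          refine tsum_congr fun n => ?_
          rw [← sum_teichChar_inv_pow_mul_pow hω, Finset.mul_sum]
          refine Finset.sum_congr rfl fun x _ => ?_
          rw [MulChar.mul_apply]
          by_cases hx : IsUnit x
          · obtain ⟨u, rfl⟩ := hx
            rw [MulChar.pow_apply_coe W, mul_pow]
            ring
          · rw [MulChar.map_nonunit _ hx]
            ring
  have hinj : Function.Injective fun k => j + (p - 1) * k := fun a b h =>
    Nat.eq_of_mul_eq_mul_left (Nat.sub_pos_of_lt hp.out.one_lt) (Nat.add_left_cancel h)
  rw [h1, ← hinj.tsum_eq]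
  · have h2 : ∀ k, b (j + (p - 1) * k) * ϖ ^ (j + (p - 1) * k) *
        (if j + (p - 1) * k ≡ j [MOD p - 1] then (p : K) - 1 else 0) =
        ((p : K) - 1) * ϖ ^ j * algebraMap ℚ_[p] K (dworkMatrix p j k k) := fun k => by
      rw [if_pos (by simp [Nat.ModEq]), dworkMatrix_diag, pow_add, pow_mul, hϖ, map_mul, map_pow,
        map_neg, map_natCast]
      ring
    rw [tsum_congr h2, tsum_mul_left, ← hΓ.one_sub_mul_tsum_dworkMatrix hp3
      (hj.trans_le (Nat.sub_le _ _)) hz, map_mul,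
      (summable_dworkMatrix_diag hp3 j).map_tsum (algebraMap ℚ_[p] K) (continuous_algebraMap _ _)]
    rw [map_sub, map_one, map_natCast]
    ring
  · refine Function.support_subset_iff'.2 fun n hn => ?_
    rw [if_neg, mul_zero]
    intro h
    refine hn ⟨n / (p - 1), ?_⟩
    have h3 : n % (p - 1) = j := by
      rw [h, Nat.mod_eq_of_lt hj]
    have := Nat.mod_add_div n (p - 1)
    rw [h3] at this
    exact this

end GaussSum

section PointCount

variable {p : ℕ} [hp : Fact p.Prime] {K : Type*} [Field K]

theorem ZMod.sum_eq_zero_add_sum_units (f : ZMod p → K) :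
    ∑ x, f x = f 0 + ∑ u : (ZMod p)ˣ, f u := by
  rw [← Finset.add_sum_erase _ _ (Finset.mem_univ 0)]
  congr 1
  symm
  refine Finset.sum_of_injOn (fun u : (ZMod p)ˣ => (u : ZMod p)) (fun u _ v _ h => Units.ext h)
    (fun u _ => by simp) (fun x hx hx' => ?_) fun u _ => rfl
  have hx0 : x ≠ 0 := by simpa using hx
  exact absurd ⟨Units.mk0 x hx0, by simp, rfl⟩ hx'

theorem gaussSum_eq_sum_units (χ : MulChar (ZMod p) K) (ψ : AddChar (ZMod p) K) :
    gaussSum χ ψ = ∑ u : (ZMod p)ˣ, χ u * ψ u := by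
  rw [gaussSum, ZMod.sum_eq_zero_add_sum_units, MulChar.map_zero, zero_mul, zero_add]

theorem sum_mulChar_mul_addChar_mul {χ : MulChar (ZMod p) K} (hχ : χ ≠ 1) (hχ2 : χ ^ 2 = 1)
    (ψ : AddChar (ZMod p) K) (u : ZMod p) :
    ∑ y : (ZMod p)ˣ, χ y * ψ (y * u) = χ u * gaussSum χ ψ := by
  by_cases hu : u = 0
  · subst hu
    have h := MulChar.sum_eq_zero_of_ne_one hχ
    rw [ZMod.sum_eq_zero_add_sum_units, MulChar.map_zero, zero_add] at h
    rw [MulChar.map_zero, zero_mul]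
    simpa using h
  · have h1 := gaussSum_mulShift χ ψ (Units.mk0 u hu)
    rw [Units.val_mk0] at h1
    have h2 : χ u * χ u = 1 := by
      have := congrArg (fun χ : MulChar (ZMod p) K => χ (Units.mk0 u hu : (ZMod p)ˣ)) hχ2
      simp only [MulChar.pow_apply_coe, MulChar.one_apply_coe] at this
      rwa [Units.val_mk0, sq] at this
    rw [← h1, ← mul_assoc, h2, one_mul, gaussSum_eq_sum_units]
    exact Finset.sum_congr rfl fun y _ => by rw [AddChar.mulShift_apply, mul_comm u]

theorem gaussSum_mul_gaussSum_inv {χ : MulChar (ZMod p) K} (hχ : χ ≠ 1) {ψ : AddChar (ZMod p) K}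
    (hψ : ψ.IsPrimitive) : gaussSum χ ψ * gaussSum χ⁻¹ ψ = χ (-1) * p := by
  have h1 := gaussSum_mul_gaussSum_eq_card hχ hψ
  have h2 := gaussSum_mulShift χ⁻¹ ψ (-1)
  have h3 : χ (-1) * χ (-1) = 1 := by rw [← map_mul]; simp
  have h4 : χ⁻¹ (-1) = χ (-1) := by
    rw [MulChar.inv_apply']
    simp
  rw [Units.val_neg, Units.val_one, h4, ← AddChar.inv_mulShift] at h2
  rw [← h2, mul_left_comm, h1, ZMod.card]

theorem gaussSum_one_eq_neg_one {ψ : AddChar (ZMod p) K} (hψ : ψ ≠ 1) :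
    gaussSum (1 : MulChar (ZMod p) K) ψ = -1 := by
  have h := AddChar.sum_eq_zero_of_ne_one hψ
  rw [ZMod.sum_eq_zero_add_sum_units, AddChar.map_zero_eq_one] at h
  rw [gaussSum_eq_sum_units, ← eq_neg_of_add_eq_zero_right h]
  exact Finset.sum_congr rfl fun u _ => by rw [MulChar.one_apply_coe, one_mul]

variable {W : MulChar (ZMod p) K}

theorem geom_sum_mulChar (hW : ∀ x, W x = 1 → x = 1) (u : (ZMod p)ˣ) :
    ∑ j ∈ Finset.range (p - 1), W u ^ j = if u = 1 then (p : K) - 1 else 0 := by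
  split_ifs with h
  · subst h
    simp [Nat.cast_sub hp.out.one_le]
  · have h1 := geom_sum_mul (W u) (p - 1)
    rw [← map_pow, ← Units.val_pow_eq_pow_val, ZMod.units_pow_card_sub_one_eq_one, Units.val_one,
      map_one, sub_self] at h1
    refine (mul_eq_zero.1 h1).resolve_right fun h2 => h (Units.ext ?_)
    exact hW _ (sub_eq_zero.1 h2)

theorem pow_eq_quadraticChar (hW : ∀ x, W x = 1 → x = 1) (hp2 : p ≠ 2) (x : ZMod p) :
    (W⁻¹ ^ ((p - 1) / 2)) x = (quadraticChar (ZMod p) x : K) := by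
  by_cases hx : x = 0
  · subst hx
    rw [MulChar.map_zero, MulChar.map_zero, Int.cast_zero]
  obtain ⟨u, rfl⟩ : ∃ u : (ZMod p)ˣ, (u : ZMod p) = x := ⟨Units.mk0 x hx, rfl⟩
  have hm1 : W (-1) = -1 := by
    have h3 : W (-1) * W (-1) = 1 := by rw [← map_mul]; simp
    refine (mul_self_eq_one_iff.1 h3).resolve_left fun h => ?_
    have := hW _ h
    exact Ring.neg_one_ne_one_of_char_ne_two (by rwa [ZMod.ringChar_zmod_n]) this
  have h1 := quadraticChar_eq_pow_of_char_ne_two' (F := ZMod p) (by rwa [ZMod.ringChar_zmod_n]) u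
  rw [ZMod.card] at h1
  have hodd := hp.out.eq_two_or_odd.resolve_left hp2
  rw [show p / 2 = (p - 1) / 2 by omega] at h1
  have hq := quadraticChar_dichotomy (F := ZMod p) hx
  rw [MulChar.pow_apply_coe, MulChar.inv_apply_eq_inv', inv_pow, ← map_pow, ← h1]
  rcases hq with h | h
  · simp [h]
  · rw [h, Int.cast_neg, Int.cast_neg, Int.cast_one, Int.cast_one, hm1, inv_neg, inv_one]

/-- The product of Gauss sums over all powers of `W` as an exponential sum in two variables. -/
theorem sum_gaussSum_mul_gaussSum_mul_gaussSum (hW : ∀ x, W x = 1 → x = 1)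
    (χ : MulChar (ZMod p) K) (ψ : AddChar (ZMod p) K)
    (c : (ZMod p)ˣ) :
    ∑ j ∈ Finset.range (p - 1), gaussSum (W ^ j) ψ * gaussSum (W⁻¹ ^ (3 * j)) ψ *
      gaussSum (χ * W ^ (2 * j)) ψ * W c ^ j =
    ((p : K) - 1) * ∑ t : (ZMod p)ˣ, ∑ s : (ZMod p)ˣ,
      χ t * ψ ((s ^ 3 * (t ^ 2 * c)⁻¹ : (ZMod p)ˣ) + s + t) := by
  have h1 : ∀ j, gaussSum (W ^ j) ψ * gaussSum (W⁻¹ ^ (3 * j)) ψ *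
      gaussSum (χ * W ^ (2 * j)) ψ * W c ^ j = ∑ t : (ZMod p)ˣ, ∑ s : (ZMod p)ˣ, ∑ r : (ZMod p)ˣ,
        χ t * ψ r * ψ s * ψ t * W (r * (s ^ 3 * (t ^ 2 * c)⁻¹)⁻¹ : (ZMod p)ˣ) ^ j := fun j => by
    have h3 : ∀ r s t : (ZMod p)ˣ,
        χ t * ψ r * ψ s * ψ t * W (r * (s ^ 3 * (t ^ 2 * c)⁻¹)⁻¹ : (ZMod p)ˣ) ^ j =
        ((χ * W ^ (2 * j)) t * ψ t * W c ^ j) *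
          (((W⁻¹ ^ (3 * j)) s * ψ s) * ((W ^ j) r * ψ r)) := fun r s t => by
      rw [MulChar.mul_apply, MulChar.pow_apply_coe, MulChar.pow_apply_coe, MulChar.pow_apply_coe,
        MulChar.inv_apply', mul_inv, inv_inv, Units.val_mul, Units.val_mul, Units.val_mul,
        Units.val_inv_eq_inv_val, Units.val_pow_eq_pow_val, Units.val_pow_eq_pow_val, ← inv_pow,
        map_mul, map_mul, map_mul, map_pow, map_pow]
      ring
    simp only [h3, ← Finset.mul_sum, ← Finset.sum_mul, ← gaussSum_eq_sum_units]
    ring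
  have h2 : ∀ r s t : (ZMod p)ˣ, ∑ j ∈ Finset.range (p - 1),
      χ t * ψ r * ψ s * ψ t * W (r * (s ^ 3 * (t ^ 2 * c)⁻¹)⁻¹ : (ZMod p)ˣ) ^ j =
      if r = s ^ 3 * (t ^ 2 * c)⁻¹ then χ t * ψ r * ψ s * ψ t * ((p : K) - 1) else 0 :=
    fun r s t => by
      rw [← Finset.mul_sum, geom_sum_mulChar hW]
      simp only [mul_inv_eq_one, mul_ite, mul_zero]
  rw [Finset.sum_congr rfl fun j _ => h1 j, Finset.sum_comm, Finset.mul_sum]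
  refine Finset.sum_congr rfl fun t _ => ?_
  rw [Finset.sum_comm, Finset.mul_sum]
  refine Finset.sum_congr rfl fun s _ => ?_
  rw [Finset.sum_comm, Finset.sum_congr rfl fun r _ => h2 r s t, Finset.sum_ite_eq' ,
    if_pos (Finset.mem_univ _), AddChar.map_add_eq_mul, AddChar.map_add_eq_mul]
  ring

theorem gaussSum_mul_sum_quadraticChar [CharZero K] (hW : ∀ x, W x = 1 → x = 1)
    (hWo : orderOf W = p - 1) (hp2 : p ≠ 2) {ψ : AddChar (ZMod p) K} (hψ : ψ.IsPrimitive)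
    {a b : ZMod p} (ha : a ≠ 0) (hb : b ≠ 0) :
    ((p : K) - 1) * (gaussSum (W⁻¹ ^ ((p - 1) / 2)) ψ *
      ∑ x, (quadraticChar (ZMod p) (x ^ 3 + a * x + b) : K)) =
    quadraticChar (ZMod p) b * (p * ∑ j ∈ Finset.range (p - 1),
      gaussSum (W⁻¹ ^ (3 * j)) ψ * gaussSum (W⁻¹ ^ ((p - 1) / 2) * W ^ (2 * j)) ψ /
        gaussSum (W⁻¹ ^ j) ψ * W (-(a ^ 3 / b ^ 2)) ^ j) := by
  have hp1 : 1 < p := hp.out.one_lt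
  have hodd := hp.out.eq_two_or_odd.resolve_left hp2
  simp only [← pow_eq_quadraticChar hW hp2]
  set φ := W⁻¹ ^ ((p - 1) / 2) with hφ
  have hφ1 : φ ≠ 1 := fun h => by
    rw [hφ, inv_pow, inv_eq_one] at h
    have := orderOf_dvd_of_pow_eq_one h
    rw [hWo] at this
    exact absurd (Nat.le_of_dvd (by omega) this) (by omega)
  have hφ2 : φ ^ 2 = 1 := by
    rw [hφ, ← pow_mul, Nat.div_mul_cancel (by omega), inv_pow, ← hWo, pow_orderOf_eq_one, inv_one]
  have hψ1 : ψ ≠ 1 := fun h => by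
    have := hψ one_ne_zero
    rw [AddChar.mulShift_one] at this
    exact this h
  have hφb : φ b * φ b = 1 := by
    rw [← MulChar.mul_apply, ← sq, hφ2, MulChar.one_apply (isUnit_iff_ne_zero.2 hb)]
  obtain ⟨a, rfl⟩ : ∃ u : (ZMod p)ˣ, (u : ZMod p) = a := ⟨Units.mk0 a ha, rfl⟩
  obtain ⟨b, rfl⟩ : ∃ u : (ZMod p)ˣ, (u : ZMod p) = b := ⟨Units.mk0 b hb, rfl⟩
  set c : (ZMod p)ˣ := a ^ 3 * (b ^ 2)⁻¹ with hc
  have hA : gaussSum φ ψ * ∑ x, φ (x ^ 3 + a * x + b) = φ b * gaussSum φ ψ +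
      ∑ y : (ZMod p)ˣ, ∑ x : (ZMod p)ˣ, φ y * ψ (y * (x ^ 3 + a * x + b)) := by
    rw [Finset.sum_comm, ZMod.sum_eq_zero_add_sum_units]
    simp only [sum_mulChar_mul_addChar_mul hφ1 hφ2]
    rw [← Finset.sum_mul]
    simp only [ne_eq, OfNat.ofNat_ne_zero, not_false_eq_true, zero_pow, mul_zero, zero_add]
    ring
  have hB : ∑ t : (ZMod p)ˣ, ∑ s : (ZMod p)ˣ,
      φ t * ψ ((s ^ 3 * (t ^ 2 * c)⁻¹ : (ZMod p)ˣ) + s + t) =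
      φ b * ∑ y : (ZMod p)ˣ, ∑ x : (ZMod p)ˣ, φ y * ψ (y * (x ^ 3 + a * x + b)) := by
    rw [Finset.mul_sum]
    refine (Fintype.sum_equiv (Equiv.mulLeft b) _ _ fun y => ?_).symm
    rw [Finset.mul_sum]
    refine Fintype.sum_equiv (Equiv.mulLeft (a * y)) _ _ fun x => ?_
    rw [Equiv.coe_mulLeft, Equiv.coe_mulLeft]
    beta_reduce
    rw [Units.val_mul b y, map_mul φ, mul_assoc (φ b)]
    congr 3
    have : (a * y * x) ^ 3 * ((b * y) ^ 2 * c)⁻¹ = y * x ^ 3 := by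
      rw [hc, mul_inv_eq_iff_eq_mul, mul_pow, mul_pow, mul_pow]
      have : (b : (ZMod p)ˣ) ^ 2 * y ^ 2 * (a ^ 3 * (b ^ 2)⁻¹) = y ^ 2 * a ^ 3 := by
        rw [mul_comm (a ^ 3), mul_comm (b ^ 2), mul_assoc, mul_inv_cancel_left]
      rw [this, pow_succ y 2]
      simp only [mul_comm, mul_left_comm, mul_assoc]
    rw [this]
    push_cast
    ring
  have hcneg : ∀ j, W (-((a : ZMod p) ^ 3 / (b : ZMod p) ^ 2)) ^ j = W (-1) ^ j * W c ^ j :=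
    fun j => by
      rw [← mul_pow, ← map_mul, hc]
      congr 2
      push_cast
      ring
  have hC := sum_gaussSum_mul_gaussSum_mul_gaussSum hW φ ψ c
  have hj : ∀ j ∈ Finset.range (p - 2), gaussSum (W ^ (j + 1)) ψ *
      gaussSum (W⁻¹ ^ (3 * (j + 1))) ψ *
      gaussSum (φ * W ^ (2 * (j + 1))) ψ * W c ^ (j + 1) =
      p * (gaussSum (W⁻¹ ^ (3 * (j + 1))) ψ * gaussSum (φ * W ^ (2 * (j + 1))) ψ /
        gaussSum (W⁻¹ ^ (j + 1)) ψ * (W (-1) ^ (j + 1) * W c ^ (j + 1))) := fun j hj => by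
    rw [Finset.mem_range] at hj
    have h1 : W ^ (j + 1) ≠ 1 := fun h => by
      have := orderOf_dvd_of_pow_eq_one h
      rw [hWo] at this
      exact absurd (Nat.le_of_dvd (by omega) this) (by omega)
    have h2 := gaussSum_mul_gaussSum_inv h1 hψ
    have h3 : (W ^ (j + 1)) (-1) = W (-1) ^ (j + 1) := by
      exact MulChar.pow_apply_coe W (j + 1) (-1)
    have h4 : (W (-1)) ^ (j + 1) ≠ 0 := pow_ne_zero _ fun h => by
      have : W (-1) * W (-1) = 1 := by rw [← map_mul]; simp
      rw [h, mul_zero] at this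
      exact zero_ne_one this
    rw [h3, ← inv_pow] at h2
    have h5 : gaussSum (W⁻¹ ^ (j + 1)) ψ ≠ 0 := fun h => by
      rw [h, mul_zero] at h2
      exact mul_ne_zero h4 (Nat.cast_ne_zero.2 hp.out.ne_zero) h2.symm
    rw [eq_div_of_mul_eq h5 h2]
    ring
  simp only [hcneg]
  rw [hB, show p - 1 = (p - 2) + 1 by omega, Finset.sum_range_succ', Finset.sum_congr rfl hj] at hC
  rw [show p - 1 = (p - 2) + 1 by omega, Finset.sum_range_succ']
  simp only [mul_zero, pow_zero, mul_one, gaussSum_one_eq_neg_one hψ1, ← Finset.mul_sum] at hA hC ⊢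
  rw [hA, show (-1 : K) * gaussSum φ ψ / -1 = gaussSum φ ψ by ring]
  linear_combination (-(φ b)) * hC - ((p : K) - 1) *
    (∑ y : (ZMod p)ˣ, φ y * ∑ x : (ZMod p)ˣ, ψ (y * (x ^ 3 + a * x + b))) * hφb

theorem prime_sub_card_eq_neg_sum_quadraticChar (hp2 : p ≠ 2) (f : ZMod p → ZMod p) :
    (p : ℤ) - ((Finset.univ.filter
      (fun xy : ZMod p × ZMod p => xy.2 ^ 2 = f xy.1)).card : ℤ) =
    -∑ x, quadraticChar (ZMod p) (f x) := by
  have h1 : (Finset.univ.filter (fun xy : ZMod p × ZMod p => xy.2 ^ 2 = f xy.1)).card =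
      ∑ x, (Finset.univ.filter (fun y : ZMod p => y ^ 2 = f x)).card := by
    simp only [Finset.card_filter]
    rw [Fintype.sum_prod_type]
  have h2 : ∀ x, ((Finset.univ.filter (fun y : ZMod p => y ^ 2 = f x)).card : ℤ) =
      quadraticChar (ZMod p) (f x) + 1 := fun x => by
    rw [← quadraticChar_card_sqrts (by rwa [ZMod.ringChar_zmod_n]) (f x)]
    congr 2
    ext y
    simp
  rw [h1, Nat.cast_sum, Finset.sum_congr rfl fun x _ => h2 x, Finset.sum_add_distrib]
  simp

end PointCount

section GammaMultiplication

variable {p : ℕ} [hp : Fact p.Prime] {Γ : ℤ_[p] → ℤ_[p]} {ω : ZMod p → ℤ_[p]}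

open Filter Topology

theorem IsPadicGamma.ne_zero (hΓ : IsPadicGamma Γ) (x : ℤ_[p]) : Γ x ≠ 0 := fun h => by
  have := hΓ.norm_eq_one x
  rw [h, norm_zero] at this
  exact zero_ne_one this

theorem IsPadicGamma.prod_neg_natCast (hΓ : IsPadicGamma Γ) {m : ℕ} {r : ℤ_[p]}
    (hr : (m : ℤ_[p]) * r = 1) (n : ℕ) :
    ∏ i ∈ Finset.range m, Γ ((-(n : ℤ_[p]) + i) * r) =
      (m : ℤ_[p]) ^ (n - n / p) * Γ (-n) * ∏ i ∈ Finset.range m, Γ (i * r) := by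
  induction n with
  | zero => simp [hΓ.zero]
  | succ n ih =>
    have hru : IsUnit r := IsUnit.of_mul_eq_one m (by rw [mul_comm, hr])
    set x : ℤ_[p] := -((n + 1 : ℕ) : ℤ_[p]) with hx
    have hxn : -(n : ℤ_[p]) = x + 1 := by rw [hx]; push_cast; ring
    have h1 : (∏ i ∈ Finset.range m, Γ ((x + 1 + i) * r)) * Γ (x * r) =
        (∏ i ∈ Finset.range m, Γ ((x + i) * r)) * Γ (x * r + 1) := by
      have h2 := Finset.prod_range_succ (fun i : ℕ => Γ ((x + i) * r)) m
      rw [Finset.prod_range_succ', Nat.cast_zero, add_zero, add_mul x m, hr] at h2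
      rw [← h2]
      refine congrArg (· * _) (Finset.prod_congr rfl fun i _ => ?_)
      push_cast
      ring_nf
    have hdvd : IsUnit x ↔ ¬ p ∣ n + 1 := by
      rw [hx, IsUnit.neg_iff, PadicInt.isUnit_natCast_iff]
    rw [hxn] at ih
    rw [ih] at h1
    have hle : n / p ≤ n := Nat.div_le_self _ _
    refine mul_right_cancel₀ (hΓ.ne_zero (x * r)) ?_
    rw [hΓ.add_one, hΓ.add_one] at h1
    by_cases hu : IsUnit x
    · have hur : IsUnit (x * r) := hu.mul hru
      simp only [hu, hur, if_true] at h1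
      have h3 : n + 1 - (n + 1) / p = n - n / p + 1 := by
        rw [Nat.succ_div, if_neg (hdvd.1 hu)]
        omega
      rw [h3]
      refine mul_right_cancel₀ (mul_ne_zero hu.ne_zero hru.ne_zero) ?_
      linear_combination h1 - (m : ℤ_[p]) ^ (n - n / p) * x * Γ x * Γ (x * r) *
        (∏ i ∈ Finset.range m, Γ (i * r)) * hr
    · have hur : ¬ IsUnit (x * r) := fun h => hu (isUnit_of_mul_isUnit_left h)
      simp only [hu, hur, if_false] at h1
      have h3 : n + 1 - (n + 1) / p = n - n / p := by
        rw [Nat.succ_div, if_pos (by simpa [hdvd] using hu)]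
        omega
      rw [h3]
      linear_combination h1

theorem IsTeichmuller.tendsto_natCast_pow (hω : IsTeichmuller ω) (m : ℕ) :
    Tendsto (fun s : ℕ => (m : ℤ_[p]) ^ p ^ s) atTop (𝓝 (ω m)) := by
  have hpow : ∀ s : ℕ, ω m ^ p ^ s = ω m := fun s => by
    have h1 : ω m ^ p = ω m := by
      have h2 : ∀ n : ℕ, ω m ^ (n + 1) = ω ((m : ZMod p) ^ (n + 1)) := fun n => by
        induction n with
        | zero => simp
        | succ n ih => rw [pow_succ, ih, pow_succ _ (n + 1), hω.mul]
      have h3 := h2 (p - 1)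
      rwa [Nat.sub_add_cancel hp.out.one_le, ZMod.pow_card] at h3
    induction s with
    | zero => simp
    | succ s ih => rw [pow_succ, pow_mul, ih, h1]
  have hdvd : (p : ℤ_[p]) ∣ (m : ℤ_[p]) - ω m := by
    have h1 : (p : ℤ_[p]) ∣ (m : ℤ_[p]) - ((m : ZMod p).val : ℤ_[p]) := by
      rw [ZMod.val_natCast]
      refine ⟨(m / p : ℕ), ?_⟩
      rw [sub_eq_iff_eq_add, ← Nat.cast_mul, ← Nat.cast_add, Nat.div_add_mod]
    have := _root_.dvd_sub h1 (hω.dvd_sub m)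
    rwa [sub_sub_sub_cancel_right] at this
  have hp1 : ‖(p : ℤ_[p])‖ < 1 := (PadicInt.norm_lt_one_iff_dvd _).2 dvd_rfl
  rw [tendsto_iff_norm_sub_tendsto_zero]
  refine squeeze_zero (fun s => norm_nonneg _) (fun s => ?_)
    (tendsto_pow_atTop_nhds_zero_of_lt_one (norm_nonneg (p : ℤ_[p])) hp1)
  have h := dvd_sub_pow_of_dvd_sub hdvd s
  rw [hpow] at h
  obtain ⟨c, hc⟩ := h
  rw [hc, norm_mul, norm_pow, pow_succ]
  calc _ ≤ ‖(p : ℤ_[p])‖ ^ s * 1 * 1 := by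
        gcongr
        · exact PadicInt.norm_le_one _
    _ = _ := by ring

/-- Multiplication formula for the `p`-adic gamma function at a rational with denominator
`p - 1`. -/
theorem IsPadicGamma.prod_add_mul (hΓ : IsPadicGamma Γ) (hω : IsTeichmuller ω) {m : ℕ}
    {r : ℤ_[p]} (hr : (m : ℤ_[p]) * r = 1) {j : ℕ} (hj : j < p) {x : ℤ_[p]}
    (hx : ((p : ℤ_[p]) - 1) * x = j) :
    ∏ i ∈ Finset.range m, Γ ((x + i) * r) =
      ω m ^ j * Γ x * ∏ i ∈ Finset.range m, Γ (i * r) := by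
  set N : ℕ → ℕ := fun s => j * ∑ i ∈ Finset.range s, p ^ i with hN
  have hNx : ∀ s, -(N s : ℤ_[p]) = x - x * p ^ s := fun s => by
    have h1 : ((p : ℤ_[p]) - 1) ≠ 0 := by
      rw [sub_ne_zero]
      exact_mod_cast hp.out.one_lt.ne'
    refine mul_left_cancel₀ h1 ?_
    have h2 := geom_sum_mul (p : ℤ_[p]) s
    simp only [hN, Nat.cast_mul, Nat.cast_sum, Nat.cast_pow]
    linear_combination (1 - (p : ℤ_[p]) ^ s) * (-hx) - (j : ℤ_[p]) * h2
  have hNs : ∀ s, N (s + 1) - N (s + 1) / p = p ^ s * j := fun s => by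
    have h1 : N (s + 1) = p * N s + j := by
      simp only [hN]
      rw [Finset.sum_range_succ', mul_add, pow_zero, mul_one, mul_left_comm]
      simp only [pow_succ', Finset.mul_sum]
    have h2 : N (s + 1) = N s + p ^ s * j := by
      simp only [hN, Finset.sum_range_succ]
      ring
    have h3 : N (s + 1) / p = N s := by
      rw [h1, Nat.mul_add_div hp.out.pos, Nat.div_eq_of_lt hj, add_zero]
    rw [h3, h2, Nat.add_sub_cancel_left]
  have hlim : Tendsto (fun s => -(N (s + 1) : ℤ_[p])) atTop (𝓝 x) := by
    simp only [hNx]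
    have hp1 : ‖(p : ℤ_[p])‖ < 1 := (PadicInt.norm_lt_one_iff_dvd _).2 dvd_rfl
    have h := (tendsto_pow_atTop_nhds_zero_of_norm_lt_one (hp1))
    have h2 := ((h.comp (tendsto_add_atTop_nat 1)).const_mul x).const_sub x
    simpa using h2
  have hcont := hΓ.continuous
  have hL : Tendsto (fun s => ∏ i ∈ Finset.range m, Γ ((-(N (s + 1) : ℤ_[p]) + i) * r)) atTop
      (𝓝 (∏ i ∈ Finset.range m, Γ ((x + i) * r))) :=
    ((by fun_prop : Continuous fun y : ℤ_[p] => ∏ i ∈ Finset.range m, Γ ((y + i) * r)).tendsto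
      x).comp hlim
  refine tendsto_nhds_unique hL ?_
  simp only [hΓ.prod_neg_natCast hr, hNs, pow_mul]
  exact (((hω.tendsto_natCast_pow m).pow j).mul ((hcont.tendsto x).comp hlim)).mul_const _

end GammaMultiplication

section RationalGamma

variable {p : ℕ} [hp : Fact p.Prime]

theorem toZp_eq {q : ℚ} {z : ℤ_[p]} (h : (z : ℚ_[p]) = q) : toZp p q = z := by
  have h1 : ‖(q : ℚ_[p])‖ ≤ 1 := h ▸ z.norm_le_one
  exact (dif_pos h1).trans (Subtype.ext h.symm)

theorem exists_sub_one_mul_eq_natCast (r : ℕ) :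
    ∃ z : ℤ_[p], ((p : ℤ_[p]) - 1) * z = r ∧ (z : ℚ_[p]) = ((r / (p - 1) : ℚ) : ℚ_[p]) := by
  have h1 : IsUnit ((p - 1 : ℕ) : ℤ_[p]) := by
    rw [PadicInt.isUnit_natCast_iff]
    exact Nat.not_dvd_of_pos_of_lt (Nat.sub_pos_of_lt hp.out.one_lt)
      (Nat.sub_lt hp.out.pos one_pos)
  rw [Nat.cast_sub hp.out.one_le, Nat.cast_one] at h1
  obtain ⟨s, hs⟩ := h1.exists_right_inv
  have h2 : ((p : ℤ_[p]) - 1) * (s * r) = r := by rw [← mul_assoc, hs, one_mul]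
  refine ⟨s * r, h2, ?_⟩
  have h3 := congrArg (fun z : ℤ_[p] => (z : ℚ_[p])) h2
  push_cast at h3 ⊢
  have h4 : (p : ℚ_[p]) - 1 ≠ 0 := by
    rw [sub_ne_zero]
    exact_mod_cast hp.out.one_lt.ne'
  rw [eq_div_iff h4, mul_comm]
  exact h3

theorem IsTeichmuller.pow_sub_one {ω : ZMod p → ℤ_[p]} (hω : IsTeichmuller ω) {x : ZMod p}
    (hx : x ≠ 0) : ω x ^ (p - 1) = 1 := by
  have h : ∀ n : ℕ, ω (x ^ n) = ω x ^ n := fun n => by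
    induction n with
    | zero => simp [hω.one]
    | succ n ih => rw [pow_succ, hω.mul, ih, pow_succ]
  rw [← h, ZMod.pow_card_sub_one_eq_one hx, hω.one]

theorem IsPadicGamma.prod_toZp {Γ : ℤ_[p] → ℤ_[p]} {ω : ZMod p → ℤ_[p]} (hΓ : IsPadicGamma Γ)
    (hω : IsTeichmuller ω) {m : ℕ} (hm : ¬ p ∣ m) {r : ℕ} (hr : r < p) :
    ∏ i ∈ Finset.range m, Γ (toZp p (((r : ℚ) / (p - 1) + i) / m)) =
      ω m ^ r * Γ (toZp p (r / (p - 1))) * ∏ i ∈ Finset.range m, Γ (toZp p (i / m)) := by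
  obtain ⟨s, hs⟩ := (PadicInt.isUnit_natCast_iff.2 hm).exists_right_inv
  obtain ⟨z, hz, hzq⟩ := exists_sub_one_mul_eq_natCast (p := p) r
  have hs' : (s : ℚ_[p]) = (m : ℚ_[p])⁻¹ := by
    have h := congrArg (fun z : ℤ_[p] => (z : ℚ_[p])) hs
    push_cast at h
    exact eq_inv_of_mul_eq_one_right h
  have h := hΓ.prod_add_mul hω hs hr hz
  rw [toZp_eq hzq]
  refine Eq.trans (Finset.prod_congr rfl fun i _ => ?_) (h.trans ?_)
  · rw [toZp_eq (z := (z + (i : ℤ_[p])) * s)]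
    push_cast
    rw [hs', hzq]
    push_cast
    rfl
  · refine congrArg (_ * ·) (Finset.prod_congr rfl fun i _ => ?_)
    rw [toZp_eq (z := (i : ℤ_[p]) * s)]
    push_cast
    rw [hs']
    rfl

end RationalGamma

section FractionalParts

theorem Int.fract_eq_and_floor_eq {x y : ℚ} {n : ℤ} (h : x = y + n) (h0 : 0 ≤ y) (h1 : y < 1) :
    Int.fract x = y ∧ ⌊x⌋ = n := by
  have h2 : ⌊x⌋ = n := Int.floor_eq_iff.2 ⟨by linarith, by linarith⟩
  exact ⟨by rw [Int.fract, h2, h]; ring, h2⟩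

theorem prod_fract_thirds {M : Type*} [CommMonoid M] (F : ℚ → M) {x y : ℚ} {k : ℕ}
    (hx0 : 0 ≤ x) (hx1 : x < 1) (hy0 : 0 ≤ y) (hy1 : y < 1) (h : 3 * y = x + k) :
    F y * F (Int.fract (-(1 / 3) + y)) * F (Int.fract (-(2 / 3) + y)) =
      ∏ i ∈ Finset.range 3, F ((x + i) / 3) ∧
    ⌊2 / 3 + y⌋ + ⌊1 / 3 + y⌋ = k := by
  have hk : k < 3 := by
    have : (k : ℚ) < 3 := by linarith
    exact_mod_cast this
  obtain rfl : y = (x + k) / 3 := by linarith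
  simp only [Finset.prod_range_succ, Finset.prod_range_zero, one_mul]
  interval_cases k
  · rw [(Int.fract_eq_and_floor_eq (x := -(1 / 3) + _) (y := (x + 2) / 3) (n := -1)
        (by push_cast; ring) (by linarith) (by linarith)).1,
      (Int.fract_eq_and_floor_eq (x := -(2 / 3) + _) (y := (x + 1) / 3) (n := -1)
        (by push_cast; ring) (by linarith) (by linarith)).1,
      (Int.fract_eq_and_floor_eq (x := 2 / 3 + _) (y := (x + 2) / 3) (n := 0)
        (by push_cast; ring) (by linarith) (by linarith)).2,
      (Int.fract_eq_and_floor_eq (x := 1 / 3 + _) (y := (x + 1) / 3) (n := 0)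
        (by push_cast; ring) (by linarith) (by linarith)).2]
    refine ⟨?_, rfl⟩
    push_cast
    rw [mul_right_comm]
  · rw [(Int.fract_eq_and_floor_eq (x := -(1 / 3) + _) (y := x / 3) (n := 0)
        (by push_cast; ring) (by linarith) (by linarith)).1,
      (Int.fract_eq_and_floor_eq (x := -(2 / 3) + _) (y := (x + 2) / 3) (n := -1)
        (by push_cast; ring) (by linarith) (by linarith)).1,
      (Int.fract_eq_and_floor_eq (x := 2 / 3 + _) (y := x / 3) (n := 1)
        (by push_cast; ring) (by linarith) (by linarith)).2,
      (Int.fract_eq_and_floor_eq (x := 1 / 3 + _) (y := (x + 2) / 3) (n := 0)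
        (by push_cast; ring) (by linarith) (by linarith)).2]
    refine ⟨?_, rfl⟩
    push_cast
    rw [add_zero, mul_comm (F ((x + 1) / 3))]
  · rw [(Int.fract_eq_and_floor_eq (x := -(1 / 3) + _) (y := (x + 1) / 3) (n := 0)
        (by push_cast; ring) (by linarith) (by linarith)).1,
      (Int.fract_eq_and_floor_eq (x := -(2 / 3) + _) (y := x / 3) (n := 0)
        (by push_cast; ring) (by linarith) (by linarith)).1,
      (Int.fract_eq_and_floor_eq (x := 2 / 3 + _) (y := (x + 1) / 3) (n := 1)
        (by push_cast; ring) (by linarith) (by linarith)).2,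
      (Int.fract_eq_and_floor_eq (x := 1 / 3 + _) (y := x / 3) (n := 1)
        (by push_cast; ring) (by linarith) (by linarith)).2]
    refine ⟨?_, rfl⟩
    push_cast
    rw [add_zero, mul_comm, mul_comm (F ((x + 2) / 3)), mul_assoc]

theorem prod_fract_quarters {M : Type*} [CommMonoid M] (F : ℚ → M) {x y : ℚ} {k : ℕ}
    (hx0 : 0 ≤ x) (hx1 : x < 1) (hy0 : 0 ≤ y) (hy1 : y < 1) (h : x + 2 * y = 1 / 2 + k) :
    F (Int.fract (1 / 4 - y)) * F (Int.fract (3 / 4 - y)) =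
      ∏ i ∈ Finset.range 2, F ((x + i) / 2) ∧
    ⌊1 / 4 - y⌋ + ⌊3 / 4 - y⌋ = -k := by
  have hk : k < 3 := by
    have : (k : ℚ) < 3 := by linarith
    exact_mod_cast this
  obtain rfl : y = (1 / 2 + k - x) / 2 := by linarith
  simp only [Finset.prod_range_succ, Finset.prod_range_zero, one_mul]
  interval_cases k
  · obtain ⟨h1, h2⟩ := Int.fract_eq_and_floor_eq (x := 1 / 4 - (1 / 2 + (0 : ℕ) - x) / 2)
      (y := x / 2) (n := 0) (by push_cast; ring) (by linarith) (by linarith)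
    obtain ⟨h3, h4⟩ := Int.fract_eq_and_floor_eq (x := 3 / 4 - (1 / 2 + (0 : ℕ) - x) / 2)
      (y := (x + 1) / 2) (n := 0) (by push_cast; ring) (by linarith) (by linarith)
    rw [h1, h2, h3, h4]
    refine ⟨?_, rfl⟩
    push_cast
    rw [add_zero]
  · obtain ⟨h1, h2⟩ := Int.fract_eq_and_floor_eq (x := 1 / 4 - (1 / 2 + (1 : ℕ) - x) / 2)
      (y := (x + 1) / 2) (n := -1) (by push_cast; ring) (by linarith) (by linarith)
    obtain ⟨h3, h4⟩ := Int.fract_eq_and_floor_eq (x := 3 / 4 - (1 / 2 + (1 : ℕ) - x) / 2)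
      (y := x / 2) (n := 0) (by push_cast; ring) (by linarith) (by linarith)
    rw [h1, h2, h3, h4]
    refine ⟨?_, rfl⟩
    push_cast
    rw [add_zero, mul_comm]
  · obtain ⟨h1, h2⟩ := Int.fract_eq_and_floor_eq (x := 1 / 4 - (1 / 2 + (2 : ℕ) - x) / 2)
      (y := x / 2) (n := -1) (by push_cast; ring) (by linarith) (by linarith)
    obtain ⟨h3, h4⟩ := Int.fract_eq_and_floor_eq (x := 3 / 4 - (1 / 2 + (2 : ℕ) - x) / 2)
      (y := (x + 1) / 2) (n := -1) (by push_cast; ring) (by linarith) (by linarith)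
    rw [h1, h2, h3, h4]
    refine ⟨?_, rfl⟩
    push_cast
    rw [add_zero]

end FractionalParts

section Assembly

variable {p : ℕ} [hp : Fact p.Prime] {Γ : ℤ_[p] → ℤ_[p]} {ω : ZMod p → ℤ_[p]}

theorem IsPadicGamma.toZp_ne_zero (hΓ : IsPadicGamma Γ) (q : ℚ) :
    (Γ (toZp p q) : ℚ_[p]) ≠ 0 := fun h => hΓ.ne_zero (toZp p q) (Subtype.ext h)

theorem gaussSum_mul_gaussSum_div_gaussSum {K : Type*} [NormedField K] [NormedAlgebra ℚ_[p] K]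
    [CompleteSpace K] [IsUltrametricDist K] (hΓ : IsPadicGamma Γ) (hω : IsTeichmuller ω)
    (hp3 : 3 < p) {ϖ : K} (hϖ : ϖ ^ (p - 1) = -p) {j h r₁ r₂ k₁ k₂ : ℕ} (hj : j < p - 1)
    (hh : h < p - 1) (hr₁ : r₁ < p - 1) (hr₂ : r₂ < p - 1) (h₁ : 3 * j = r₁ + k₁ * (p - 1))
    (h₂ : r₂ + 2 * j = h + k₂ * (p - 1)) :
    gaussSum ((teichChar K hω)⁻¹ ^ (3 * j)) (dworkChar hp3 hϖ) *
      gaussSum ((teichChar K hω)⁻¹ ^ h * teichChar K hω ^ (2 * j)) (dworkChar hp3 hϖ) /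
      gaussSum ((teichChar K hω)⁻¹ ^ j) (dworkChar hp3 hϖ) =
    gaussSum ((teichChar K hω)⁻¹ ^ h) (dworkChar hp3 hϖ) *
      algebraMap ℚ_[p] K ((-(p : ℚ_[p])) ^ ((k₂ : ℤ) - k₁) *
        ((Γ (toZp p (r₁ / (p - 1))) : ℚ_[p]) * Γ (toZp p (r₂ / (p - 1))) /
          (Γ (toZp p (j / (p - 1))) * Γ (toZp p (h / (p - 1)))))) := by
  have hGK : ∀ r : ℕ, r < p - 1 → gaussSum ((teichChar K hω)⁻¹ ^ r) (dworkChar hp3 hϖ) =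
      -(ϖ ^ r * algebraMap ℚ_[p] K (Γ (toZp p (r / (p - 1))))) := fun r hr => by
    obtain ⟨z, hz, hzq⟩ := exists_sub_one_mul_eq_natCast (p := p) r
    rw [toZp_eq hzq]
    exact hΓ.gaussSum_eq hp3 hϖ hω hr hz
  have hW : teichChar K hω ^ (p - 1) = 1 := by
    rw [← orderOf_teichChar (K := K) hω, pow_orderOf_eq_one]
  have hW' : (teichChar K hω)⁻¹ ^ (p - 1) = 1 := by rw [inv_pow, hW, inv_one]
  have hc₁ : (teichChar K hω)⁻¹ ^ (3 * j) = (teichChar K hω)⁻¹ ^ r₁ := by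
    rw [h₁, pow_add, mul_comm k₁, pow_mul, hW', one_pow, mul_one]
  have hc₂ : (teichChar K hω)⁻¹ ^ h * teichChar K hω ^ (2 * j) = (teichChar K hω)⁻¹ ^ r₂ := by
    have h3 : (teichChar K hω)⁻¹ ^ r₂ * (teichChar K hω)⁻¹ ^ (2 * j) =
        (teichChar K hω)⁻¹ ^ h := by
      rw [← pow_add, h₂, pow_add, mul_comm k₂, pow_mul, hW', one_pow, mul_one]
    rw [← h3, mul_assoc, inv_pow _ (2 * j), inv_mul_cancel, mul_one]
  have hp0 : (p : K) ≠ 0 := by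
    rw [← map_natCast (algebraMap ℚ_[p] K), map_ne_zero]
    exact Nat.cast_ne_zero.2 hp.out.ne_zero
  have hϖ0 : ϖ ≠ 0 := fun h => by
    rw [h, zero_pow (Nat.sub_pos_of_lt hp.out.one_lt).ne'] at hϖ
    exact neg_ne_zero.2 hp0 hϖ.symm
  have hexp : ϖ ^ r₁ * ϖ ^ r₂ * (-(p : K)) ^ k₁ = ϖ ^ j * ϖ ^ h * (-(p : K)) ^ k₂ := by
    rw [← hϖ, ← pow_mul, ← pow_mul, ← pow_add, ← pow_add, ← pow_add, ← pow_add]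
    congr 1
    rw [mul_comm _ k₁, mul_comm _ k₂]
    omega
  have hne : ∀ q, algebraMap ℚ_[p] K (Γ (toZp p q)) ≠ 0 := fun q =>
    (map_ne_zero _).2 (hΓ.toZp_ne_zero q)
  rw [hc₁, hc₂, hGK _ hj, hGK _ hh, hGK _ hr₁, hGK _ hr₂, map_mul, map_zpow₀, map_div₀, map_mul,
    map_mul, map_neg, map_natCast, zpow_sub₀ (neg_ne_zero.2 hp0), zpow_natCast, zpow_natCast]
  have h1 := hne (j / (p - 1))
  have h2 := hne (h / (p - 1))
  have h3 : (-(p : K)) ^ k₁ ≠ 0 := pow_ne_zero _ (neg_ne_zero.2 hp0)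
  generalize algebraMap ℚ_[p] K (Γ (toZp p (j / (p - 1)))) = Gj at *
  generalize algebraMap ℚ_[p] K (Γ (toZp p (h / (p - 1)))) = Gh at *
  generalize algebraMap ℚ_[p] K (Γ (toZp p (r₁ / (p - 1)))) = G₁ at *
  generalize algebraMap ℚ_[p] K (Γ (toZp p (r₂ / (p - 1)))) = G₂ at *
  generalize (-(p : K)) ^ k₁ = P₁ at *
  generalize (-(p : K)) ^ k₂ = P₂ at *
  have h4 : ϖ ^ j ≠ 0 := pow_ne_zero _ hϖ0
  field_simp
  linear_combination (-(G₁ * G₂)) * hexp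

theorem summand_eq (hΓ : IsPadicGamma Γ) (hω : IsTeichmuller ω) (hp3 : 3 < p)
    {j r₁ r₂ k₁ k₂ : ℕ} (hj : j < p - 1)
    (hr₁ : r₁ < p - 1) (hr₂ : r₂ < p - 1) (h₁ : 3 * j = r₁ + k₁ * (p - 1))
    (h₂ : r₂ + 2 * j = (p - 1) / 2 + k₂ * (p - 1)) {a b : ZMod p} (ha : a ≠ 0) (hb : b ≠ 0) :
    ((-(p : ℚ_[p])) ^ ((k₂ : ℤ) - k₁) *
        ((Γ (toZp p (r₁ / (p - 1))) : ℚ_[p]) * Γ (toZp p (r₂ / (p - 1))) /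
          (Γ (toZp p (j / (p - 1))) * Γ (toZp p (((p - 1) / 2 : ℕ) / (p - 1)))))) *
      (ω (-(a ^ 3 / b ^ 2)) : ℚ_[p]) ^ j =
    (-1 : ℚ_[p]) ^ (j * 2) * (((ω (-27 * b ^ 2 / (4 * a ^ 3)) : ℚ_[p]))⁻¹ ^ j) *
    ∏ i : Fin 2,
      ((Γ (toZp p (Int.fract ((![1/4, 3/4] : Fin 2 → ℚ) i - (j : ℚ) / ((p : ℚ) - 1)))) : ℚ_[p]) /
          (Γ (toZp p (Int.fract ((![1/4, 3/4] : Fin 2 → ℚ) i))) : ℚ_[p]) *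
        ((Γ (toZp p (Int.fract
            (-((![1/3, 2/3] : Fin 2 → ℚ) i) + (j : ℚ) / ((p : ℚ) - 1)))) : ℚ_[p]) /
          (Γ (toZp p (Int.fract (-((![1/3, 2/3] : Fin 2 → ℚ) i)))) : ℚ_[p])) *
        (-(p : ℚ_[p])) ^
          (-Int.floor (Int.fract ((![1/4, 3/4] : Fin 2 → ℚ) i) - (j : ℚ) / ((p : ℚ) - 1)) -
            Int.floor (Int.fract (-((![1/3, 2/3] : Fin 2 → ℚ) i)) + (j : ℚ) / ((p : ℚ) - 1)))) := by
  have hp0 : (p : ℚ_[p]) ≠ 0 := Nat.cast_ne_zero.2 hp.out.ne_zero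
  have hn0 : (0 : ℚ) < (p : ℚ) - 1 := by
    rw [sub_pos]
    exact_mod_cast hp.out.one_lt
  have hcast : ((p - 1 : ℕ) : ℚ) = p - 1 := by
    rw [Nat.cast_sub hp.out.one_le, Nat.cast_one]
  have hhalf : 2 * ((p - 1) / 2) = p - 1 := by
    have := hp.out.eq_two_or_odd
    omega
  have hhalfq : (((p - 1) / 2 : ℕ) : ℚ) / (p - 1) = 1 / 2 := by
    rw [← hcast, div_eq_div_iff (by rw [hcast]; exact hn0.ne') two_ne_zero, one_mul, mul_comm]
    exact_mod_cast hhalf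
  have hbd : ∀ r : ℕ, r < p - 1 → (0 : ℚ) ≤ (r : ℚ) / (p - 1) ∧ (r : ℚ) / (p - 1) < 1 :=
    fun r hr => by
      refine ⟨by positivity, ?_⟩
      rw [div_lt_one hn0, ← hcast]
      exact_mod_cast hr
  have hq₁ : 3 * ((j : ℚ) / (p - 1)) = (r₁ : ℚ) / (p - 1) + k₁ := by
    have : (3 * j : ℚ) = r₁ + k₁ * (p - 1) := by
      rw [← hcast]
      exact_mod_cast h₁
    field_simp
    linarith
  have hq₂ : (r₂ : ℚ) / (p - 1) + 2 * ((j : ℚ) / (p - 1)) = 1 / 2 + k₂ := by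
    have : (r₂ + 2 * j : ℚ) = ((p - 1) / 2 : ℕ) + k₂ * (p - 1) := by
      rw [← hcast]
      exact_mod_cast h₂
    rw [← hhalfq]
    field_simp
    linarith
  set F : ℚ → ℚ_[p] := fun q => Γ (toZp p q) with hF
  have hFne : ∀ q, F q ≠ 0 := hΓ.toZp_ne_zero
  have hF0 : F 0 = 1 := by
    have : toZp p 0 = 0 := toZp_eq (by simp)
    simp [hF, this, hΓ.zero]
  have hprod : ∀ m : ℕ, ¬ p ∣ m → ∀ r : ℕ, r < p - 1 →
      ∏ i ∈ Finset.range m, F (((r : ℚ) / (p - 1) + i) / m) =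
      (ω m : ℚ_[p]) ^ r * F (r / (p - 1)) * ∏ i ∈ Finset.range m, F (i / m) := fun m hm r hr => by
    have h := congrArg PadicInt.Coe.ringHom (hΓ.prod_toZp hω hm (r := r) (by omega))
    rw [map_mul, map_mul, map_pow, map_prod, map_prod] at h
    exact h
  have hp2' : ¬ p ∣ 2 := Nat.not_dvd_of_pos_of_lt (by norm_num) (by omega)
  have hp3' : ¬ p ∣ 3 := Nat.not_dvd_of_pos_of_lt (by norm_num) (by omega)
  obtain ⟨e3, f3⟩ := prod_fract_thirds F (hbd _ hr₁).1 (hbd _ hr₁).2 (hbd _ hj).1 (hbd _ hj).2 hq₁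
  obtain ⟨e2, f2⟩ :=
    prod_fract_quarters F (hbd _ hr₂).1 (hbd _ hr₂).2 (hbd _ hj).1 (hbd _ hj).2 hq₂
  have e3' := hprod 3 hp3' r₁ hr₁
  have e2' := hprod 2 hp2' r₂ hr₂
  have e2'' := hprod 2 hp2' ((p - 1) / 2) (by omega)
  push_cast at e3' e2' e2''
  rw [e3'] at e3
  rw [e2'] at e2
  rw [hhalfq] at e2''
  simp only [Finset.prod_range_succ, Finset.prod_range_zero, one_mul, Nat.cast_zero, zero_div, hF0,
    Nat.cast_one, Nat.cast_ofNat, add_zero] at e3 e2 e2''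
  rw [show (1 / 2 : ℚ) / 2 = 1 / 4 by norm_num, show (1 / 2 + 1 : ℚ) / 2 = 3 / 4 by norm_num] at e2''
  have g2 : (2 : ZMod p) ≠ 0 := by
    rw [← Nat.cast_ofNat, Ne, ZMod.natCast_eq_zero_iff]
    exact hp2'
  have g3 : (3 : ZMod p) ≠ 0 := by
    rw [← Nat.cast_ofNat, Ne, ZMod.natCast_eq_zero_iff]
    exact hp3'
  have wne : ∀ x : ZMod p, x ≠ 0 → (ω x : ℚ_[p]) ≠ 0 := fun x hx h =>
    (hω.isUnit x hx).ne_zero (Subtype.ext h)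
  have wpow : ∀ x : ZMod p, x ≠ 0 → (ω x : ℚ_[p]) ^ (p - 1) = 1 := fun x hx => by
    have h := congrArg (fun z : ℤ_[p] => (z : ℚ_[p])) (hω.pow_sub_one hx)
    push_cast at h
    exact h
  have wmul : ∀ x y : ZMod p, (ω (x * y) : ℚ_[p]) = ω x * ω y := fun x y => by
    rw [hω.mul, PadicInt.coe_mul]
  have w3 : (ω 3 : ℚ_[p]) ^ r₁ = (ω 3 : ℚ_[p]) ^ (3 * j) := by
    rw [h₁, pow_add, mul_comm k₁, pow_mul _ (p - 1), wpow 3 g3, one_pow, mul_one]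
  have w2 : (ω 2 : ℚ_[p]) ^ ((p - 1) / 2) = (ω 2 : ℚ_[p]) ^ r₂ * (ω 2 : ℚ_[p]) ^ (2 * j) := by
    rw [← pow_add, h₂, pow_add, mul_comm k₂, pow_mul _ (p - 1), wpow 2 g2, one_pow, mul_one]
  have ht : -27 * b ^ 2 / (4 * a ^ 3) ≠ 0 := by
    have h27 : (-27 : ZMod p) = -(3 * (3 * 3)) := by norm_num
    have h4 : (4 : ZMod p) = 2 * 2 := by norm_num
    rw [h27, h4]
    simp [g2, g3, ha, hb]
  have wt : (ω (-27 * b ^ 2 / (4 * a ^ 3)) : ℚ_[p]) * ω (-(a ^ 3 / b ^ 2)) * ω 2 ^ 2 =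
      (ω 3 : ℚ_[p]) ^ 3 := by
    rw [sq (ω 2 : ℚ_[p]), pow_succ (ω 3 : ℚ_[p]), sq (ω 3 : ℚ_[p]), ← wmul, ← wmul, ← wmul, ← wmul,
      ← wmul]
    congr 2
    have h4 : (4 : ZMod p) = 2 * 2 := by norm_num
    rw [h4]
    field_simp
    norm_num
  have wtj := congrArg (· ^ j) wt
  simp only [mul_pow, ← pow_mul] at wtj
  have c1 : Int.fract (1 / 4 : ℚ) = 1 / 4 := Int.fract_eq_self.2 (by norm_num)
  have c2 : Int.fract (3 / 4 : ℚ) = 3 / 4 := Int.fract_eq_self.2 (by norm_num)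
  have c3 : Int.fract (-(1 / 3) : ℚ) = 2 / 3 :=
    (Int.fract_eq_and_floor_eq (n := -1) (by norm_num) (by norm_num) (by norm_num)).1
  have c4 : Int.fract (-(2 / 3) : ℚ) = 1 / 3 :=
    (Int.fract_eq_and_floor_eq (n := -1) (by norm_num) (by norm_num) (by norm_num)).1
  rw [Fin.prod_univ_two]
  simp only [Matrix.cons_val_zero, Matrix.cons_val_one, c1, c2, c3, c4, hhalfq]
  rw [pow_mul', neg_one_sq, one_pow, one_mul]
  have hexp : (k₂ : ℤ) - k₁ =
      (-⌊1 / 4 - (j : ℚ) / (p - 1)⌋ - ⌊2 / 3 + (j : ℚ) / (p - 1)⌋) +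
        (-⌊3 / 4 - (j : ℚ) / (p - 1)⌋ - ⌊1 / 3 + (j : ℚ) / (p - 1)⌋) := by omega
  rw [hexp, zpow_add₀ (neg_ne_zero.2 hp0)]
  generalize (-(p : ℚ_[p])) ^ (-⌊1 / 4 - (j : ℚ) / (p - 1)⌋ - ⌊2 / 3 + (j : ℚ) / (p - 1)⌋) = P₁
  generalize (-(p : ℚ_[p])) ^ (-⌊3 / 4 - (j : ℚ) / (p - 1)⌋ - ⌊1 / 3 + (j : ℚ) / (p - 1)⌋) = P₂
  have n1 := hFne (j / (p - 1))
  have n2 := hFne (1 / 2)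
  have n3 := hFne (1 / 3)
  have n4 := hFne (2 / 3)
  have n5 := hFne (1 / 4)
  have n6 := hFne (3 / 4)
  have n7 := pow_ne_zero j (wne _ ht)
  have n8 := pow_ne_zero r₂ (wne _ g2)
  have n9 := pow_ne_zero (2 * j) (wne _ g2)
  change P₁ * P₂ * (F (r₁ / (p - 1)) * F (r₂ / (p - 1)) / (F (j / (p - 1)) * F (1 / 2))) * _ =
    _ * (F (Int.fract (1 / 4 - j / (p - 1))) / F (1 / 4) *
        (F (Int.fract (-(1 / 3) + j / (p - 1))) / F (2 / 3)) * P₁ *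
      (F (Int.fract (3 / 4 - j / (p - 1))) / F (3 / 4) *
        (F (Int.fract (-(2 / 3) + j / (p - 1))) / F (1 / 3)) * P₂))
  rw [w3, ← wtj] at e3
  rw [w2] at e2''
  rw [inv_pow]
  generalize F (Int.fract (1 / 4 - j / (p - 1))) = A₁ at *
  generalize F (Int.fract (3 / 4 - j / (p - 1))) = A₂ at *
  generalize F (Int.fract (-(1 / 3) + j / (p - 1))) = B₁ at *
  generalize F (Int.fract (-(2 / 3) + j / (p - 1))) = B₂ at *
  generalize F (j / (p - 1)) = Fj at *
  generalize F (r₁ / (p - 1)) = F₁ at *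
  generalize F (r₂ / (p - 1)) = F₂ at *
  generalize F (1 / 2) = h₂ at *
  generalize F (1 / 3) = t₁ at *
  generalize F (2 / 3) = t₂ at *
  generalize F (1 / 4) = q₁ at *
  generalize F (3 / 4) = q₂ at *
  generalize (ω (-27 * b ^ 2 / (4 * a ^ 3)) : ℚ_[p]) ^ j = x at *
  generalize (ω (-(a ^ 3 / b ^ 2)) : ℚ_[p]) ^ j = y at *
  generalize (ω 2 : ℚ_[p]) ^ (2 * j) = u at *
  generalize (ω 2 : ℚ_[p]) ^ r₂ = v at *
  calc P₁ * P₂ * (F₁ * F₂ / (Fj * h₂)) * y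
      = x⁻¹ * ((v * F₂ * h₂) * (x * y * u * F₁ * (t₁ * t₂)) / (v * u * h₂ * h₂) /
        (Fj * t₁ * t₂) * P₁ * P₂) := by
        field_simp
    _ = _ := by
        rw [← e2, ← e3, ← e2'']
        field_simp

end Assembly

/-- **Theorem 1.1 (McCarthy)**: for a prime `p > 3` and an elliptic curve
`E : y² = x³ + ax + b` over `𝔽_p` with `j(E) ≠ 0, 1728`, the trace of Frobenius satisfies
`a_p(E) = φ(b) · p · ₂G₂[1/4, 3/4; 1/3, 2/3 | -27b²/(4a³)]_p`.
Here `Γ` is Morita's `p`-adic gamma function (characterized by continuity, `Γ 0 = 1` and its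
values at positive integers) and `ω` is the Teichmüller character (characterized as the
multiplicative character with unit values on `𝔽_p^*` satisfying `ω(x) ≡ x (mod p)`). -/
theorem trace_of_frobenius_eq_padicG (p : ℕ) [Fact p.Prime] (hp3 : 3 < p)
    (Γ : ℤ_[p] → ℤ_[p]) (hΓcont : Continuous Γ) (hΓzero : Γ 0 = 1)
    (hΓnat : ∀ m : ℕ, 0 < m →
      Γ (m : ℤ_[p]) = (-1) ^ m * ∏ k ∈ (Finset.Ico 1 m).filter (fun k => ¬ p ∣ k), (k : ℤ_[p]))
    (ω : ZMod p → ℤ_[p]) (hω0 : ω 0 = 0)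
    (hωmul : ∀ x y : ZMod p, ω (x * y) = ω x * ω y)
    (hωunit : ∀ x : ZMod p, x ≠ 0 → IsUnit (ω x))
    (hωcong : ∀ x : ZMod p, (p : ℤ_[p]) ∣ (ω x - (x.val : ℤ_[p])))
    (a b : ZMod p) (ha : a ≠ 0) (hb : b ≠ 0) (hns : 4 * a ^ 3 + 27 * b ^ 2 ≠ 0) :
    ((p : ℚ_[p]) -
        ((Finset.univ.filter
          (fun xy : ZMod p × ZMod p => xy.2 ^ 2 = xy.1 ^ 3 + a * xy.1 + b)).card : ℚ_[p])) =
      (quadraticChar (ZMod p) b : ℚ_[p]) * (p : ℚ_[p]) *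
        padicG p Γ ω 2 ![1/4, 3/4] ![1/3, 2/3] (-27 * b ^ 2 / (4 * a ^ 3)) := by
  have hp : p.Prime := Fact.out
  have hp2 : p ≠ 2 := by omega
  have hΓ : IsPadicGamma Γ := ⟨hΓcont, hΓzero, hΓnat⟩
  have hω : IsTeichmuller ω := ⟨hω0, hωmul, hωunit, hωcong⟩
  obtain ⟨ϖ, hϖ⟩ := IsAlgClosed.exists_pow_nat_eq (-(p : ℂ_[p])) (Nat.sub_pos_of_lt hp.one_lt)
  set W := teichChar ℂ_[p] hω
  set ψ := dworkChar hp3 hϖ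
  set ι := algebraMap ℚ_[p] ℂ_[p]
  have hψ : ψ.IsPrimitive := dworkChar_isPrimitive hp3 hϖ
  have hcount := gaussSum_mul_sum_quadraticChar (W := W) (fun _ => eq_one_of_teichChar_eq_one hω)
    (orderOf_teichChar hω) hp2 hψ ha hb
  set g := gaussSum (W⁻¹ ^ ((p - 1) / 2)) ψ
  set s : ℕ → ℚ_[p] := fun j =>
    (-1 : ℚ_[p]) ^ (j * 2) * (((ω (-27 * b ^ 2 / (4 * a ^ 3)) : ℚ_[p]))⁻¹ ^ j) *
    ∏ i : Fin 2,
      ((Γ (toZp p (Int.fract ((![1/4, 3/4] : Fin 2 → ℚ) i - (j : ℚ) / ((p : ℚ) - 1)))) : ℚ_[p]) /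
          (Γ (toZp p (Int.fract ((![1/4, 3/4] : Fin 2 → ℚ) i))) : ℚ_[p]) *
        ((Γ (toZp p (Int.fract
            (-((![1/3, 2/3] : Fin 2 → ℚ) i) + (j : ℚ) / ((p : ℚ) - 1)))) : ℚ_[p]) /
          (Γ (toZp p (Int.fract (-((![1/3, 2/3] : Fin 2 → ℚ) i)))) : ℚ_[p])) *
        (-(p : ℚ_[p])) ^
          (-Int.floor (Int.fract ((![1/4, 3/4] : Fin 2 → ℚ) i) - (j : ℚ) / ((p : ℚ) - 1)) -
            Int.floor (Int.fract (-((![1/3, 2/3] : Fin 2 → ℚ) i)) + (j : ℚ) / ((p : ℚ) - 1))))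
  have hterm : ∀ j ∈ Finset.range (p - 1), gaussSum (W⁻¹ ^ (3 * j)) ψ *
      gaussSum (W⁻¹ ^ ((p - 1) / 2) * W ^ (2 * j)) ψ / gaussSum (W⁻¹ ^ j) ψ *
        W (-(a ^ 3 / b ^ 2)) ^ j = g * ι (s j) := fun j hj => by
    rw [Finset.mem_range] at hj
    obtain ⟨k₂, r₂, hr₂, h₂⟩ : ∃ k r, r < p - 1 ∧ r + 2 * j = (p - 1) / 2 + k * (p - 1) := by
      by_cases h0 : 2 * j ≤ (p - 1) / 2
      · exact ⟨0, (p - 1) / 2 - 2 * j, by omega, by omega⟩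
      by_cases h1 : 2 * j ≤ (p - 1) / 2 + (p - 1)
      · exact ⟨1, (p - 1) / 2 + (p - 1) - 2 * j, by omega, by omega⟩
      · exact ⟨2, (p - 1) / 2 + 2 * (p - 1) - 2 * j, by omega, by omega⟩
    have hr₁ : 3 * j % (p - 1) < p - 1 := Nat.mod_lt _ (by omega)
    have h₁ : 3 * j = 3 * j % (p - 1) + 3 * j / (p - 1) * (p - 1) := by
      rw [mul_comm (3 * j / (p - 1)), Nat.mod_add_div]
    rw [gaussSum_mul_gaussSum_div_gaussSum hΓ hω hp3 hϖ hj (by omega) hr₁ hr₂ h₁ h₂, mul_assoc,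
      teichChar_apply, ← map_pow, ← map_mul, summand_eq hΓ hω hp3 hj hr₁ hr₂ h₁ h₂ ha hb]
  rw [Finset.sum_congr rfl hterm, ← Finset.mul_sum, ← map_sum] at hcount
  have hg : g ≠ 0 := fun h => by
    have hφ : W⁻¹ ^ ((p - 1) / 2) ≠ 1 := fun h1 => by
      rw [inv_pow, inv_eq_one] at h1
      have := orderOf_dvd_of_pow_eq_one h1
      rw [orderOf_teichChar] at this
      exact absurd (Nat.le_of_dvd (by omega) this) (by omega)
    have h2 := gaussSum_mul_gaussSum_eq_card hφ hψ
    rw [show gaussSum (W⁻¹ ^ ((p - 1) / 2)) ψ = 0 from h, zero_mul, ZMod.card] at h2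
    exact Nat.cast_ne_zero.2 hp.ne_zero h2.symm
  have hcount' : ((p : ℚ_[p]) - 1) * ∑ x, (quadraticChar (ZMod p) (x ^ 3 + a * x + b) : ℚ_[p]) =
      quadraticChar (ZMod p) b * (p * ∑ j ∈ Finset.range (p - 1), s j) := by
    refine ι.injective (mul_left_cancel₀ hg ?_)
    simp only [map_mul, map_sub, map_natCast, map_one, map_intCast]
    rw [map_sum ι (fun x => (quadraticChar (ZMod p) (x ^ 3 + a * x + b) : ℚ_[p]))]
    simp only [map_intCast]
    linear_combination hcount
  have hp1 : (p : ℚ_[p]) - 1 ≠ 0 := by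
    rw [sub_ne_zero]
    exact_mod_cast hp.one_lt.ne'
  have hcard := prime_sub_card_eq_neg_sum_quadraticChar hp2 fun x : ZMod p => x ^ 3 + a * x + b
  have hcard' := congrArg (Int.cast : ℤ → ℚ_[p]) hcard
  push_cast at hcard'
  rw [hcard', padicG]
  change _ = _ * _ * (_ * ∑ j ∈ Finset.range (p - 1), s j)
  refine mul_left_cancel₀ hp1 ?_
  rw [mul_neg, hcount']
  field_simp
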